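/- arXiv:2504.11490 — 14 statements merged into one kernel-verified Lean document; each statement's English description precedes it below -/
import Mathlib

section
/- Let f : [m, M] → (0, ∞) be continuous and log-convex. Then for every unit vector x ∈ E, f(⟨Tx, x⟩) ≤ exp ⟨(ln∘f)(T) x, x⟩ ≤ ⟨f(T) x, x⟩. -/
open scoped InnerProductSpace

theorem mond_aux
    {E : Type*} [NormedAddCommGroup E] [InnerProductSpace ℂ E] [CompleteSpace E]
    (T : E →L[ℂ] E) (hT : IsSelfAdjoint T) (g h : ℝ → ℝ) (c d : ℝ)
    (hg : ContinuousOn g (spectrum ℝ T)) (hh : ContinuousOn h (spectrum ℝ T))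
    (hle : ∀ t ∈ spectrum ℝ T, c * h t + d ≤ g t) (x : E) (hx : ‖x‖ = 1) :
    c * RCLike.re ⟪(cfc h T) x, x⟫_ℂ + d ≤ RCLike.re ⟪(cfc g T) x, x⟫_ℂ := by
  have hch : ContinuousOn (fun t => c * h t) (spectrum ℝ T) := continuousOn_const.mul hh
  have hcd : ContinuousOn (fun t => c * h t + d) (spectrum ℝ T) := hch.add continuousOn_const
  have h1 : cfc (fun t => c * h t + d) T ≤ cfc g T := cfc_mono hle hcd hg
  rw [cfc_add_const d (fun t => c * h t) T hch hT, cfc_const_mul c h T hh] at h1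
  have h2 := ((ContinuousLinearMap.le_def _ _).1 h1).re_inner_nonneg_left x
  have h3 : algebraMap ℝ (E →L[ℂ] E) d = ((d : ℂ)) • (1 : E →L[ℂ] E) := by
    rw [Algebra.algebraMap_eq_smul_one]; rfl
  have h4 : c • cfc h T = (c : ℂ) • cfc h T := rfl
  have h5 : ⟪x, x⟫_ℂ = 1 := by simp [inner_self_eq_norm_sq_to_K, hx]
  rw [h3, h4] at h2
  simp only [_root_.sub_apply, _root_.add_apply,
    _root_.smul_apply, one_apply_eq_self, inner_sub_left,
    inner_add_left, inner_smul_left, h5, map_sub, map_add] at h2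
  simp at h2 ⊢
  linarith

theorem quaternionic_mond_pecaric_log_convex
    {E : Type*} [NormedAddCommGroup E] [InnerProductSpace ℂ E] [CompleteSpace E]
    (T : E →L[ℂ] E) (hT : IsSelfAdjoint T) (m M : ℝ) (hmM : m < M)
    (hspec : spectrum ℝ T ⊆ Set.Icc m M)
    (f : ℝ → ℝ) (hf_cont : ContinuousOn f (Set.Icc m M))
    (hf_pos : ∀ t ∈ Set.Icc m M, 0 < f t)
    (hf_logconv : ConvexOn ℝ (Set.Icc m M) (fun t => Real.log (f t)))
    (x : E) (hx : ‖x‖ = 1) :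
    f (RCLike.re ⟪T x, x⟫_ℂ) ≤
        Real.exp (RCLike.re ⟪(cfc (fun t => Real.log (f t)) T) x, x⟫_ℂ) ∧
    Real.exp (RCLike.re ⟪(cfc (fun t => Real.log (f t)) T) x, x⟫_ℂ) ≤
        RCLike.re ⟪(cfc f T) x, x⟫_ℂ := by
  have hlog : ContinuousOn (fun t => Real.log (f t)) (Set.Icc m M) :=
    hf_cont.log fun t ht => (hf_pos t ht).ne'
  have hid : cfc (id : ℝ → ℝ) T = T := cfc_id ℝ T hT
  have hmem : RCLike.re ⟪T x, x⟫_ℂ ∈ Set.Icc m M := by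
    constructor
    · have := mond_aux T hT id id 0 m continuousOn_id continuousOn_id
        (fun t ht => by simpa using (hspec ht).1) x hx
      rw [hid] at this
      linarith
    · have h2 := mond_aux T hT (fun _ => 0) id 1 (-M) continuousOn_const continuousOn_id
        (fun t ht => by have := (hspec ht).2; simp; linarith) x hx
      rw [hid, cfc_const_zero] at h2
      simp at h2 ⊢
      linarith
  constructor
  · rw [← Real.log_le_iff_le_exp (hf_pos _ hmem)]
    refine le_of_forall_lt fun a ha => ?_
    obtain ⟨b, hab, hb⟩ := exists_between ha
    obtain ⟨c, d, hle, heq⟩ := hf_logconv.exists_affine_le_of_lt_real hmem hb isClosed_Icc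
      hlog.lowerSemicontinuousOn
    have := mond_aux T hT (fun t => Real.log (f t)) id c d (hlog.mono hspec) continuousOn_id
      (fun t ht => hle t (hspec ht)) x hx
    rw [hid] at this
    linarith
  · set s := RCLike.re ⟪(cfc (fun t => Real.log (f t)) T) x, x⟫_ℂ with hs
    have := mond_aux T hT f (fun t => Real.log (f t)) (Real.exp s) (Real.exp s * (1 - s))
      (hf_cont.mono hspec) (hlog.mono hspec) (fun t ht => by
        have h1 := Real.add_one_le_exp (Real.log (f t) - s)
        have h2 := mul_le_mul_of_nonneg_left h1 (Real.exp_pos s).le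
        rw [← Real.exp_add, add_sub_cancel, Real.exp_log (hf_pos t (hspec ht))] at h2
        linarith) x hx
    rw [← hs] at this
    linarith
end

section
/- Let f : [m, M] → (0, ∞) be continuous and log-convex, let T₁, …, Tₙ be bounded selfadjoint operators on E with σ(T_j) ⊆ [m, M] for each j, and let x₁, …, xₙ ∈ E satisfy ∑_{j=1}^n ‖x_j‖² = 1. Then f(∑_{j=1}^n ⟨T_j x_j, x_j⟩) ≤ exp(∑_{j=1}^n ⟨(ln∘f)(T_j) x_j, x_j⟩) ≤ ∑_{j=1}^n ⟨f(T_j) x_j, x_j⟩. -/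
open scoped InnerProductSpace

theorem aux_affine_le
    {E : Type*} [NormedAddCommGroup E] [InnerProductSpace ℂ E] [CompleteSpace E]
    (m M : ℝ) (u v : ℝ → ℝ) (hu : ContinuousOn u (Set.Icc m M))
    (hv : ContinuousOn v (Set.Icc m M)) (c d : ℝ)
    (h : ∀ t ∈ Set.Icc m M, c * u t + d ≤ v t)
    (n : ℕ) (T : Fin n → (E →L[ℂ] E)) (hT : ∀ j, IsSelfAdjoint (T j))
    (hspec : ∀ j, spectrum ℝ (T j) ⊆ Set.Icc m M)
    (x : Fin n → E) (hx : ∑ j, ‖x j‖ ^ 2 = 1) :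
    c * (∑ j, RCLike.re ⟪(cfc u (T j)) (x j), x j⟫_ℂ) + d ≤
      ∑ j, RCLike.re ⟪(cfc v (T j)) (x j), x j⟫_ℂ := by
  have key : ∀ j, c * RCLike.re ⟪(cfc u (T j)) (x j), x j⟫_ℂ + d * ‖x j‖ ^ 2 ≤
      RCLike.re ⟪(cfc v (T j)) (x j), x j⟫_ℂ := by
    intro j
    have hu' := hu.mono (hspec j)
    have hv' := hv.mono (hspec j)
    have h1 : cfc (fun t => c * u t + d) (T j) ≤ cfc v (T j) :=
      cfc_mono (fun t ht => h t (hspec j ht)) (by fun_prop) hv'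
    have h2 : cfc (fun t => c * u t + d) (T j) = c • cfc u (T j) + algebraMap ℝ _ d := by
      rw [cfc_add_const d (fun t => c * u t) (T j) (by fun_prop) (hT j),
        cfc_const_mul c u (T j) hu']
    rw [h2, ContinuousLinearMap.le_def] at h1
    have h3 := h1.re_inner_nonneg_left (x j)
    have h4 : (algebraMap ℝ (E →L[ℂ] E) d) (x j) = d • x j := by
      rw [Algebra.algebraMap_eq_smul_one]; rfl
    simp only [sub_apply, add_apply,
      smul_apply, h4, inner_sub_left, inner_add_left,
      inner_smul_left_eq_smul, map_sub, map_add, RCLike.smul_re, inner_self_eq_norm_sq] at h3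
    linarith
  calc _ = ∑ j, (c * RCLike.re ⟪(cfc u (T j)) (x j), x j⟫_ℂ + d * ‖x j‖ ^ 2) := by
        rw [Finset.sum_add_distrib, ← Finset.mul_sum, ← Finset.mul_sum, hx, mul_one]
    _ ≤ _ := Finset.sum_le_sum fun j _ => key j

theorem mond_pecaric_log_convex_sum
    {E : Type*} [NormedAddCommGroup E] [InnerProductSpace ℂ E] [CompleteSpace E]
    (m M : ℝ) (hmM : m < M)
    (f : ℝ → ℝ) (hf_cont : ContinuousOn f (Set.Icc m M))
    (hf_pos : ∀ t ∈ Set.Icc m M, 0 < f t)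
    (hf_logconv : ConvexOn ℝ (Set.Icc m M) (fun t => Real.log (f t)))
    (n : ℕ) (T : Fin n → (E →L[ℂ] E)) (hT : ∀ j, IsSelfAdjoint (T j))
    (hspec : ∀ j, spectrum ℝ (T j) ⊆ Set.Icc m M)
    (x : Fin n → E) (hx : ∑ j, ‖x j‖ ^ 2 = 1) :
    f (∑ j, RCLike.re ⟪(T j) (x j), x j⟫_ℂ) ≤
        Real.exp (∑ j, RCLike.re ⟪(cfc (fun t => Real.log (f t)) (T j)) (x j), x j⟫_ℂ) ∧
    Real.exp (∑ j, RCLike.re ⟪(cfc (fun t => Real.log (f t)) (T j)) (x j), x j⟫_ℂ) ≤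
        ∑ j, RCLike.re ⟪(cfc f (T j)) (x j), x j⟫_ℂ := by
  have hg : ContinuousOn (fun t => Real.log (f t)) (Set.Icc m M) :=
    hf_cont.log fun t ht => (hf_pos t ht).ne'
  have hid : ContinuousOn (fun t : ℝ => t) (Set.Icc m M) := continuousOn_id
  have e : ∀ j, cfc (fun t : ℝ => t) (T j) = T j := fun j => cfc_id' ℝ (T j) (hT j)
  have lin := fun (v : ℝ → ℝ) hv c d h =>
    aux_affine_le m M (fun t => t) v hid hv c d h n T hT hspec x hx
  simp only [e] at lin
  constructor
  · have hs : (∑ j, RCLike.re ⟪(T j) (x j), x j⟫_ℂ) ∈ Set.Icc m M := by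
      constructor
      · have := aux_affine_le m M (fun t => t) (fun t => t) hid hid 0 m
          (fun t ht => by linarith [ht.1]) n T hT hspec x hx
        simp only [e] at this
        linarith
      · have h1 := lin (fun _ => M) continuousOn_const 1 0 (fun t ht => by linarith [ht.2])
        have h2 := aux_affine_le m M (fun _ => M) (fun _ => M) continuousOn_const
          continuousOn_const 2 (-M) (fun t ht => by linarith) n T hT hspec x hx
        linarith
    rw [← Real.log_le_iff_le_exp (hf_pos _ hs)]
    refine le_of_forall_lt fun a ha => ?_
    obtain ⟨b, hab, hb⟩ := exists_between ha
    obtain ⟨c, d, hle, heq⟩ := hf_logconv.exists_affine_le_of_lt_real hs hb isClosed_Icc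
      hg.lowerSemicontinuousOn
    have := lin _ hg c d hle
    linarith
  · set y := ∑ j, RCLike.re ⟪(cfc (fun t => Real.log (f t)) (T j)) (x j), x j⟫_ℂ with hy
    have := aux_affine_le m M _ f hg hf_cont (Real.exp y) (Real.exp y * (1 - y)) (fun t ht => by
      have h1 := Real.add_one_le_exp (Real.log (f t) - y)
      have h2 : f t = Real.exp y * Real.exp (Real.log (f t) - y) := by
        rw [← Real.exp_add, add_sub_cancel, Real.exp_log (hf_pos t ht)]
      have h3 := mul_le_mul_of_nonneg_left h1 (Real.exp_pos y).le
      rw [← h2] at h3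
      linarith) n T hT hspec x hx
    rw [← hy] at this
    linarith
end

section
/- Let T be positive and invertible with σ(T) ⊆ [m, M] and 0 < m < M, and let r < 0. Then for every unit vector x ∈ E, ⟨Tx, x⟩^r ≤ exp ⟨(t ↦ ln(t^r))(T) x, x⟩ ≤ ⟨T^r x, x⟩. -/
open scoped InnerProductSpace

lemma hm_affine_le
    {E : Type*} [NormedAddCommGroup E] [InnerProductSpace ℂ E] [CompleteSpace E]
    (T : E →L[ℂ] E) (hT : IsSelfAdjoint T) (x : E) (hx : ‖x‖ = 1)
    (f g : ℝ → ℝ) (hf : ContinuousOn f (spectrum ℝ T)) (hg : ContinuousOn g (spectrum ℝ T))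
    (a b : ℝ) (h : ∀ t ∈ spectrum ℝ T, a + b * f t ≤ g t) :
    a + b * RCLike.re ⟪(cfc f T) x, x⟫_ℂ ≤ RCLike.re ⟪(cfc g T) x, x⟫_ℂ := by
  have hle : cfc (fun t => a + b * f t) T ≤ cfc g T :=
    cfc_mono h (by fun_prop) hg
  have e : cfc (fun t => a + b * f t) T = algebraMap ℝ (E →L[ℂ] E) a + b • cfc f T := by
    rw [cfc_const_add a (fun t => b * f t) T (by fun_prop) hT, cfc_const_mul b f T hf]
  rw [e, ContinuousLinearMap.le_def] at hle
  have h2 := hle.re_inner_nonneg_left x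
  have h3 : (algebraMap ℝ (E →L[ℂ] E) a) x = (a : ℂ) • x := by
    rw [Algebra.algebraMap_eq_smul_one]; simp
  have h4 : (b • cfc f T) x = (b : ℂ) • (cfc f T) x := by simp
  have h5 : RCLike.re ⟪x, x⟫_ℂ = 1 := by
    rw [inner_self_eq_norm_sq, hx]; norm_num
  rw [sub_apply, add_apply, h3, h4, inner_sub_left, inner_add_left,
    inner_smul_left, inner_smul_left] at h2
  simp only [RCLike.re_to_complex, Complex.conj_ofReal, Complex.sub_re, Complex.add_re,
    Complex.re_ofReal_mul] at h2 h5 ⊢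
  rw [h5] at h2
  linarith

theorem holder_mccarthy_refinement_neg_power
    {E : Type*} [NormedAddCommGroup E] [InnerProductSpace ℂ E] [CompleteSpace E]
    (T : E →L[ℂ] E) (hT : IsSelfAdjoint T) (m M : ℝ) (h0m : 0 < m) (hmM : m < M)
    (hspec : spectrum ℝ T ⊆ Set.Icc m M)
    (hpos : ∀ y : E, 0 ≤ RCLike.re ⟪T y, y⟫_ℂ) (hinv : IsUnit T)
    (r : ℝ) (hr : r < 0)
    (x : E) (hx : ‖x‖ = 1) :
    (RCLike.re ⟪T x, x⟫_ℂ) ^ r ≤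
        Real.exp (RCLike.re ⟪(cfc (fun t : ℝ => Real.log (t ^ r)) T) x, x⟫_ℂ) ∧
    Real.exp (RCLike.re ⟪(cfc (fun t : ℝ => Real.log (t ^ r)) T) x, x⟫_ℂ) ≤
        RCLike.re ⟪(cfc (fun t : ℝ => t ^ r) T) x, x⟫_ℂ := by
  have hp : ∀ t ∈ spectrum ℝ T, 0 < t := fun t ht => h0m.trans_le (hspec ht).1
  have hc : ContinuousOn (fun t : ℝ => t ^ r) (spectrum ℝ T) :=
    continuousOn_id.rpow_const fun t ht => Or.inl (hp t ht).ne'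
  have hl : ContinuousOn (fun t : ℝ => Real.log (t ^ r)) (spectrum ℝ T) :=
    hc.log fun t ht => (Real.rpow_pos_of_pos (hp t ht) r).ne'
  have hid : cfc (fun t : ℝ => t) T = T := cfc_id' ℝ T
  have hi : ContinuousOn (fun t : ℝ => t) (spectrum ℝ T) := continuousOn_id
  constructor
  · have ha := hm_affine_le T hT x hx (fun t => t) (fun t => t) hi hi m 0
      (fun t ht => by simpa using (hspec ht).1)
    have key := fun a b => hm_affine_le T hT x hx (fun t => t) _ hi hl a b
    rw [hid] at ha
    rw [hid] at key
    set A := RCLike.re ⟪T x, x⟫_ℂ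
    have hA : 0 < A := by linarith
    have k := key (r * Real.log A - r) (r / A) (fun t ht => by
      have ht := hp t ht
      rw [Real.log_rpow ht]
      have h1 := Real.log_le_sub_one_of_pos (div_pos ht hA)
      rw [Real.log_div ht.ne' hA.ne'] at h1
      have h2 := mul_le_mul_of_nonpos_left h1 hr.le
      have h3 : r / A * t = r * (t / A) := by ring
      rw [h3]; linarith)
    rw [div_mul_cancel₀ _ hA.ne'] at k
    rw [Real.rpow_def_of_pos hA]
    apply Real.exp_le_exp.2
    linarith
  · have key := fun a b => hm_affine_le T hT x hx _ _ hl hc a b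
    set c := RCLike.re ⟪(cfc (fun t : ℝ => Real.log (t ^ r)) T) x, x⟫_ℂ
    have k := key (Real.exp c * (1 - c)) (Real.exp c) (fun t ht => by
      have h1 := Real.add_one_le_exp (Real.log (t ^ r) - c)
      have h2 := mul_le_mul_of_nonneg_left h1 (Real.exp_pos c).le
      rw [← Real.exp_add, add_sub_cancel, Real.exp_log (Real.rpow_pos_of_pos (hp t ht) r)] at h2
      linarith)
    linarith
end

section
/- Let f : [m, M] → (0, ∞) be log-convex and continuous, and let g : [m, M] → (0, ∞) be defined by g(t) = f(m)^{(M−t)/(M−m)} · f(M)^{(t−m)/(M−m)}. Then for every unit vector x ∈ E, ⟨f(T) x, x⟩ ≤ ⟨g(T) x, x⟩ ≤ ((M − ⟨Tx, x⟩)/(M−m)) f(m) + ((⟨Tx, x⟩ − m)/(M−m)) f(M). -/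
open scoped InnerProductSpace

theorem lah_ribaric_log_convex_upper
    {E : Type*} [NormedAddCommGroup E] [InnerProductSpace ℂ E] [CompleteSpace E]
    (T : E →L[ℂ] E) (hT : IsSelfAdjoint T) (m M : ℝ) (hmM : m < M)
    (hspec : spectrum ℝ T ⊆ Set.Icc m M)
    (f : ℝ → ℝ) (hf_cont : ContinuousOn f (Set.Icc m M))
    (hf_pos : ∀ t ∈ Set.Icc m M, 0 < f t)
    (hf_logconv : ConvexOn ℝ (Set.Icc m M) (fun t => Real.log (f t)))
    (g : ℝ → ℝ)
    (hg : ∀ t, g t = f m ^ ((M - t) / (M - m)) * f M ^ ((t - m) / (M - m)))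
    (x : E) (hx : ‖x‖ = 1) :
    RCLike.re ⟪(cfc f T) x, x⟫_ℂ ≤ RCLike.re ⟪(cfc g T) x, x⟫_ℂ ∧
    RCLike.re ⟪(cfc g T) x, x⟫_ℂ ≤
        ((M - RCLike.re ⟪T x, x⟫_ℂ) / (M - m)) * f m +
        ((RCLike.re ⟪T x, x⟫_ℂ - m) / (M - m)) * f M := by
  have hd : 0 < M - m := sub_pos.mpr hmM
  have hfm : 0 < f m := hf_pos m ⟨le_rfl, hmM.le⟩
  have hfM : 0 < f M := hf_pos M ⟨hmM.le, le_rfl⟩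
  have hg_eq : g = fun t => f m ^ ((M - t) / (M - m)) * f M ^ ((t - m) / (M - m)) := funext hg
  have hg_cont : Continuous g := by
    rw [hg_eq]
    refine Continuous.mul ?_ ?_
    · exact Continuous.rpow continuous_const (by fun_prop) (fun _ => Or.inl hfm.ne')
    · exact Continuous.rpow continuous_const (by fun_prop) (fun _ => Or.inl hfM.ne')
  have key : ∀ A B : E →L[ℂ] E, A ≤ B → RCLike.re ⟪A x, x⟫_ℂ ≤ RCLike.re ⟪B x, x⟫_ℂ := by
    intro A B hAB
    have h := (ContinuousLinearMap.le_def A B).mp hAB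
    have h2 := h.re_inner_nonneg_left x
    rw [ContinuousLinearMap.sub_apply, inner_sub_left, map_sub] at h2
    linarith
  have hw : ∀ t ∈ Set.Icc m M, 0 ≤ (M - t) / (M - m) ∧ 0 ≤ (t - m) / (M - m) ∧
      (M - t) / (M - m) + (t - m) / (M - m) = 1 := by
    intro t ht
    refine ⟨div_nonneg (by linarith [ht.2]) hd.le, div_nonneg (by linarith [ht.1]) hd.le, ?_⟩
    field_simp
    ring
  constructor
  · apply key
    refine cfc_mono (fun t ht => ?_) (hf_cont.mono hspec) hg_cont.continuousOn
    have ht' := hspec ht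
    obtain ⟨h1, h2, h3⟩ := hw t ht'
    have hc := hf_logconv.2 (x := m) (y := M) ⟨le_rfl, hmM.le⟩ ⟨hmM.le, le_rfl⟩ h1 h2 h3
    have he : ((M - t) / (M - m)) • m + ((t - m) / (M - m)) • M = t := by
      simp only [smul_eq_mul]
      field_simp
      ring
    rw [he] at hc
    simp only [smul_eq_mul] at hc
    rw [hg, Real.rpow_def_of_pos hfm, Real.rpow_def_of_pos hfM, ← Real.exp_add,
      ← Real.log_le_iff_le_exp (hf_pos t ht')]
    linarith
  · set a := (f M - f m) / (M - m) with ha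
    set b := (M * f m - m * f M) / (M - m) with hb
    have hle : cfc g T ≤ cfc (fun t : ℝ => b + a * t) T := by
      refine cfc_mono (fun t ht => ?_) hg_cont.continuousOn (by fun_prop)
      obtain ⟨h1, h2, h3⟩ := hw t (hspec ht)
      rw [hg]
      refine (Real.geom_mean_le_arith_mean2_weighted h1 h2 hfm.le hfM.le h3).trans (le_of_eq ?_)
      rw [ha, hb]
      field_simp
      ring
    have hlin : cfc (fun t : ℝ => b + a * t) T = algebraMap ℝ (E →L[ℂ] E) b + a • T := by
      rw [cfc_const_add b (fun t => a * t) T (by fun_prop) hT, cfc_const_mul_id a T hT]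
    rw [hlin] at hle
    refine (key _ _ hle).trans (le_of_eq ?_)
    have hxx : RCLike.re ⟪x, x⟫_ℂ = 1 := by
      rw [inner_self_eq_norm_sq, hx]; norm_num
    have hcalc : RCLike.re ⟪(algebraMap ℝ (E →L[ℂ] E) b + a • T) x, x⟫_ℂ
        = b + a * RCLike.re ⟪T x, x⟫_ℂ := by
      rw [Algebra.algebraMap_eq_smul_one, ContinuousLinearMap.add_apply, inner_add_left, map_add,
        ContinuousLinearMap.smul_apply, ContinuousLinearMap.smul_apply,
        ContinuousLinearMap.one_apply, inner_smul_left_eq_smul, inner_smul_left_eq_smul,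
        RCLike.smul_re, RCLike.smul_re, hxx, mul_one]
    rw [hcalc, ha, hb]
    field_simp
    ring
end

section
/- Let f : [m, M] → (0, ∞) be log-convex and continuous, and let g : [m, M] → (0, ∞) be defined by g(t) = f(m)^{(M−t)/(M−m)} · f(M)^{(t−m)/(M−m)}. Then for every unit vector x ∈ E, f(⟨Tx, x⟩) ≤ f(m)^{(M−⟨Tx,x⟩)/(M−m)} · f(M)^{(⟨Tx,x⟩−m)/(M−m)} ≤ ⟨g(T) x, x⟩. -/
open scoped InnerProductSpace

lemma lah_aux {E : Type*} [NormedAddCommGroup E] [InnerProductSpace ℂ E] [CompleteSpace E]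
    (T : E →L[ℂ] E) (hT : IsSelfAdjoint T) (h : ℝ → ℝ) (hh : Continuous h) (c d : ℝ)
    (hle : ∀ t ∈ spectrum ℝ T, c + d * t ≤ h t) (x : E) (hx : ‖x‖ = 1) :
    c + d * RCLike.re ⟪T x, x⟫_ℂ ≤ RCLike.re ⟪(cfc h T) x, x⟫_ℂ := by
  have h1 : cfc (fun t : ℝ => c + d * t) T ≤ cfc h T :=
    cfc_mono hle (by fun_prop) hh.continuousOn
  rw [cfc_const_add c (fun t => d * t) T (by fun_prop) hT, cfc_const_mul_id d T hT] at h1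
  have h2 := ((ContinuousLinearMap.le_def _ _).1 h1).re_inner_nonneg_left x
  have h3 : (algebraMap ℝ (E →L[ℂ] E) c) x = (c : ℂ) • x := by
    rw [Algebra.algebraMap_eq_smul_one]; simp
  have h4 : (d • T) x = (d : ℂ) • T x := by simp
  have h5 : ⟪x, x⟫_ℂ = 1 := by rw [inner_self_eq_norm_sq_to_K, hx]; simp
  rw [ContinuousLinearMap.sub_apply, ContinuousLinearMap.add_apply, h3, h4, inner_sub_left,
    inner_add_left, inner_smul_left, inner_smul_left, h5] at h2
  simp at h2 ⊢
  linarith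

theorem lah_ribaric_log_convex_lower
    {E : Type*} [NormedAddCommGroup E] [InnerProductSpace ℂ E] [CompleteSpace E]
    (T : E →L[ℂ] E) (hT : IsSelfAdjoint T) (m M : ℝ) (hmM : m < M)
    (hspec : spectrum ℝ T ⊆ Set.Icc m M)
    (f : ℝ → ℝ) (hf_cont : ContinuousOn f (Set.Icc m M))
    (hf_pos : ∀ t ∈ Set.Icc m M, 0 < f t)
    (hf_logconv : ConvexOn ℝ (Set.Icc m M) (fun t => Real.log (f t)))
    (g : ℝ → ℝ)
    (hg : ∀ t, g t = f m ^ ((M - t) / (M - m)) * f M ^ ((t - m) / (M - m)))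
    (x : E) (hx : ‖x‖ = 1) :
    f (RCLike.re ⟪T x, x⟫_ℂ) ≤
        f m ^ ((M - RCLike.re ⟪T x, x⟫_ℂ) / (M - m)) *
        f M ^ ((RCLike.re ⟪T x, x⟫_ℂ - m) / (M - m)) ∧
    f m ^ ((M - RCLike.re ⟪T x, x⟫_ℂ) / (M - m)) *
        f M ^ ((RCLike.re ⟪T x, x⟫_ℂ - m) / (M - m)) ≤
        RCLike.re ⟪(cfc g T) x, x⟫_ℂ := by
  have hmI : m ∈ Set.Icc m M := ⟨le_rfl, hmM.le⟩
  have hMI : M ∈ Set.Icc m M := ⟨hmM.le, le_rfl⟩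
  have hfm := hf_pos m hmI
  have hfM := hf_pos M hMI
  have hd : 0 < M - m := sub_pos.2 hmM
  have hg' : ∀ t, g t = Real.exp (Real.log (f m) * ((M - t) / (M - m)) +
      Real.log (f M) * ((t - m) / (M - m))) := by
    intro t
    rw [hg, Real.rpow_def_of_pos hfm, Real.rpow_def_of_pos hfM, Real.exp_add]
  have hgc : Continuous g := by
    rw [funext hg']; fun_prop
  have hms : m ≤ RCLike.re ⟪T x, x⟫_ℂ := by
    have := lah_aux T hT (fun t => t) continuous_id m 0
      (fun t ht => by simpa using (hspec ht).1) x hx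
    rw [cfc_id' ℝ T hT] at this
    simpa using this
  have hsM : RCLike.re ⟪T x, x⟫_ℂ ≤ M := by
    have := lah_aux T hT (fun t => -t) continuous_neg (-M) 0
      (fun t ht => by simpa using (hspec ht).2) x hx
    rw [cfc_neg_id (R := ℝ) T hT] at this
    simpa using this
  have hkey : g (RCLike.re ⟪T x, x⟫_ℂ) ≤ RCLike.re ⟪(cfc g T) x, x⟫_ℂ := by
    generalize hs : RCLike.re ⟪T x, x⟫_ℂ = s
    have := lah_aux T hT g hgc
      (g s - g s * ((Real.log (f M) - Real.log (f m)) / (M - m)) * s)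
      (g s * ((Real.log (f M) - Real.log (f m)) / (M - m))) (fun t _ => by
        have e : g t = g s *
            Real.exp ((Real.log (f M) - Real.log (f m)) / (M - m) * (t - s)) := by
          rw [hg', hg', ← Real.exp_add]
          congr 1
          field_simp
          ring
        have hp : 0 < g s := by rw [hg']; exact Real.exp_pos _
        rw [e]
        nlinarith [mul_le_mul_of_nonneg_left (Real.add_one_le_exp
          ((Real.log (f M) - Real.log (f m)) / (M - m) * (t - s))) hp.le]) x hx
    rw [hs] at this
    linarith
  rw [← hg]
  refine ⟨?_, hkey⟩
  generalize RCLike.re ⟪T x, x⟫_ℂ = s at hms hsM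
  rw [hg', ← Real.log_le_iff_le_exp (hf_pos s ⟨hms, hsM⟩)]
  have hc := hf_logconv.2 hmI hMI (div_nonneg (sub_nonneg.2 hsM) hd.le)
    (div_nonneg (sub_nonneg.2 hms) hd.le) (by field_simp; ring)
  have hcomb : ((M - s) / (M - m)) • m + ((s - m) / (M - m)) • M = s := by
    simp only [smul_eq_mul]; field_simp; ring
  rw [hcomb] at hc
  simp only [smul_eq_mul] at hc
  linarith
end

section
/- Let T be positive and invertible with σ(T) ⊆ [m, M] and 0 < m < M, let r < 0, and let h : [m, M] → (0, ∞) be defined by h(t) = (m^{(M−t)/(M−m)} · M^{(t−m)/(M−m)})^r. Then for every unit vector x ∈ E: (i) ⟨T^r x, x⟩ ≤ ⟨h(T) x, x⟩ ≤ ((M − ⟨Tx,x⟩)/(M−m)) m^r + ((⟨Tx,x⟩ − m)/(M−m)) M^r; and (ii) ⟨Tx, x⟩^r ≤ (m^{(M−⟨Tx,x⟩)/(M−m)} · M^{(⟨Tx,x⟩−m)/(M−m)})^r ≤ ⟨h(T) x, x⟩. -/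
open scoped InnerProductSpace

theorem lr_mono {E : Type*} [NormedAddCommGroup E] [InnerProductSpace ℂ E] [CompleteSpace E]
    (T : E →L[ℂ] E) (m M : ℝ)
    (hspec : spectrum ℝ T ⊆ Set.Icc m M) (f g : ℝ → ℝ)
    (hf : ContinuousOn f (Set.Icc m M)) (hg : ContinuousOn g (Set.Icc m M))
    (hfg : ∀ t ∈ Set.Icc m M, f t ≤ g t) (x : E) :
    RCLike.re ⟪(cfc f T) x, x⟫_ℂ ≤ RCLike.re ⟪(cfc g T) x, x⟫_ℂ := by
  have h1 : cfc f T ≤ cfc g T :=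
    cfc_mono (fun t ht => hfg t (hspec ht)) (hf.mono hspec) (hg.mono hspec)
  rw [ContinuousLinearMap.le_def] at h1
  have h2 := h1.re_inner_nonneg_left x
  simp only [ContinuousLinearMap.sub_apply, inner_sub_left, map_sub] at h2
  linarith

theorem lr_affine {E : Type*} [NormedAddCommGroup E] [InnerProductSpace ℂ E] [CompleteSpace E]
    (T : E →L[ℂ] E) (hT : IsSelfAdjoint T) (a b : ℝ) (x : E) (hx : ‖x‖ = 1) :
    RCLike.re ⟪(cfc (fun t : ℝ => a * t + b) T) x, x⟫_ℂ = a * RCLike.re ⟪T x, x⟫_ℂ + b := by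
  have h1 : cfc (fun t : ℝ => a * t + b) T = a • T + b • (1 : E →L[ℂ] E) := by
    rw [cfc_add_const b (fun t : ℝ => a * t) T, cfc_const_mul_id a T, Algebra.algebraMap_eq_smul_one]
  have h2 : ⟪x, x⟫_ℂ = 1 := by
    rw [inner_self_eq_norm_sq_to_K, hx]; simp
  rw [h1]
  simp only [ContinuousLinearMap.add_apply, ContinuousLinearMap.smul_apply, inner_add_left,
    ContinuousLinearMap.one_apply, map_add, real_inner_smul_left]
  rw [← Complex.coe_smul a, ← Complex.coe_smul b, inner_smul_left, inner_smul_left, h2]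
  simp

theorem lah_ribaric_neg_power
    {E : Type*} [NormedAddCommGroup E] [InnerProductSpace ℂ E] [CompleteSpace E]
    (T : E →L[ℂ] E) (hT : IsSelfAdjoint T) (m M : ℝ) (h0m : 0 < m) (hmM : m < M)
    (hspec : spectrum ℝ T ⊆ Set.Icc m M)
    (hpos : ∀ y : E, 0 ≤ RCLike.re ⟪T y, y⟫_ℂ) (hinv : IsUnit T)
    (r : ℝ) (hr : r < 0)
    (h : ℝ → ℝ)
    (hh : ∀ t, h t = (m ^ ((M - t) / (M - m)) * M ^ ((t - m) / (M - m))) ^ r)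
    (x : E) (hx : ‖x‖ = 1) :
    (RCLike.re ⟪(cfc (fun t : ℝ => t ^ r) T) x, x⟫_ℂ ≤ RCLike.re ⟪(cfc h T) x, x⟫_ℂ ∧
      RCLike.re ⟪(cfc h T) x, x⟫_ℂ ≤
        ((M - RCLike.re ⟪T x, x⟫_ℂ) / (M - m)) * m ^ r +
        ((RCLike.re ⟪T x, x⟫_ℂ - m) / (M - m)) * M ^ r) ∧
    ((RCLike.re ⟪T x, x⟫_ℂ) ^ r ≤
        (m ^ ((M - RCLike.re ⟪T x, x⟫_ℂ) / (M - m)) *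
         M ^ ((RCLike.re ⟪T x, x⟫_ℂ - m) / (M - m))) ^ r ∧
      (m ^ ((M - RCLike.re ⟪T x, x⟫_ℂ) / (M - m)) *
         M ^ ((RCLike.re ⟪T x, x⟫_ℂ - m) / (M - m))) ^ r ≤
        RCLike.re ⟪(cfc h T) x, x⟫_ℂ) := by
  have hd : 0 < M - m := sub_pos.2 hmM
  have h0M : 0 < M := h0m.trans hmM
  set s : ℝ := RCLike.re ⟪T x, x⟫_ℂ with hs
  obtain ⟨c, d, hcd⟩ : ∃ c d : ℝ, ∀ t, h t = Real.exp (c * t + d) := by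
    refine ⟨r * (Real.log M - Real.log m) / (M - m),
      r * (M * Real.log m - m * Real.log M) / (M - m), fun t => ?_⟩
    rw [hh, Real.rpow_def_of_pos h0m, Real.rpow_def_of_pos h0M, ← Real.exp_add, ← Real.exp_mul]
    congr 1
    field_simp
    ring
  have hhc : Continuous h := by
    rw [funext hcd]; fun_prop
  have hsc : ∀ t ∈ Set.Icc m M, t ^ r ≤ h t := by
    intro t ht
    rw [hh]
    refine Real.rpow_le_rpow_of_nonpos (by positivity) ?_ hr.le
    have := Real.geom_mean_le_arith_mean2_weighted (w₁ := (M - t) / (M - m))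
      (w₂ := (t - m) / (M - m)) (p₁ := m) (p₂ := M) (div_nonneg (by linarith [ht.2]) hd.le)
      (div_nonneg (by linarith [ht.1]) hd.le) h0m.le h0M.le (by field_simp; ring)
    refine this.trans (le_of_eq ?_)
    field_simp
    ring
  have hup : ∀ t ∈ Set.Icc m M, h t ≤ (M - t) / (M - m) * m ^ r + (t - m) / (M - m) * M ^ r := by
    intro t ht
    have := Real.geom_mean_le_arith_mean2_weighted (w₁ := (M - t) / (M - m))
      (w₂ := (t - m) / (M - m)) (p₁ := m ^ r) (p₂ := M ^ r)
      (div_nonneg (by linarith [ht.2]) hd.le)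
      (div_nonneg (by linarith [ht.1]) hd.le) (by positivity) (by positivity) (by field_simp; ring)
    refine le_trans (le_of_eq ?_) this
    rw [hh, Real.mul_rpow (by positivity) (by positivity), ← Real.rpow_mul h0m.le,
      ← Real.rpow_mul h0M.le, ← Real.rpow_mul h0m.le, ← Real.rpow_mul h0M.le, mul_comm r,
      mul_comm r]
  have hid : RCLike.re ⟪(cfc (fun t : ℝ => t) T) x, x⟫_ℂ = s := by
    rw [cfc_id' ℝ T]
  have hsm : s ∈ Set.Icc m M := by
    constructor
    · have := lr_mono T m M hspec (fun t => 0 * t + m) (fun t => t) (by fun_prop) (by fun_prop)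
        (fun t ht => by simpa using ht.1) x
      rw [hid, lr_affine T hT _ _ x hx] at this
      linarith
    · have := lr_mono T m M hspec (fun t => t) (fun t => 0 * t + M) (by fun_prop) (by fun_prop)
        (fun t ht => by simpa using ht.2) x
      rw [hid, lr_affine T hT _ _ x hx] at this
      linarith
  refine ⟨⟨?_, ?_⟩, ?_, ?_⟩
  · refine lr_mono T m M hspec _ _ ?_ hhc.continuousOn hsc x
    exact fun t ht => (Real.continuousAt_rpow_const t r
      (Or.inl (h0m.trans_le ht.1).ne')).continuousWithinAt
  · have := lr_mono T m M hspec h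
      (fun t => ((M ^ r - m ^ r) / (M - m)) * t + (M * m ^ r - m * M ^ r) / (M - m))
      hhc.continuousOn (by fun_prop)
      (fun t ht => (hup t ht).trans (le_of_eq (by field_simp; ring))) x
    rw [lr_affine T hT _ _ x hx] at this
    refine this.trans (le_of_eq ?_)
    rw [← hs]
    field_simp
    ring
  · rw [← hh]
    exact hsc s hsm
  · rw [← hh]
    have := lr_mono T m M hspec (fun t => (h s * c) * t + (h s - h s * c * s)) h
      (by fun_prop) hhc.continuousOn (fun t _ => by
        have h1 : h t = h s * Real.exp (c * t - c * s) := by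
          rw [hcd, hcd, ← Real.exp_add]; congr 1; ring
        have h2 := Real.add_one_le_exp (c * t - c * s)
        have h3 : 0 < h s := by rw [hcd]; positivity
        have h4 := mul_le_mul_of_nonneg_left h2 h3.le
        show h s * c * t + (h s - h s * c * s) ≤ h t
        rw [h1]
        linarith) x
    rw [lr_affine T hT _ _ x hx] at this
    linarith
end

section
/- Let J be an interval and f : J → ℝ a differentiable function on the interior of J whose derivative f′ is continuous there, and suppose σ(T) ⊆ [m, M] ⊂ interior of J. If f is convex on the interior of J, then for every unit vector x ∈ E, 0 ≤ ⟨f(T) x, x⟩ − f(⟨Tx, x⟩) ≤ ⟨(t ↦ t·f′(t))(T) x, x⟩ − ⟨Tx, x⟩ · ⟨f′(T) x, x⟩. -/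
open scoped InnerProductSpace

theorem tangent_le_aux {S : Set ℝ} {f : ℝ → ℝ} (hconv : ConvexOn ℝ S f) {s t d : ℝ}
    (hs : s ∈ S) (ht : t ∈ S) (hd : HasDerivAt f d s) : f s + d * (t - s) ≤ f t := by
  rcases lt_trichotomy s t with h | h | h
  · have h1 := hconv.le_slope_of_hasDerivAt hs ht h hd
    rw [slope_def_field, le_div_iff₀ (by linarith)] at h1
    linarith
  · subst h; simp
  · have h1 := hconv.slope_le_of_hasDerivAt ht hs h hd
    rw [slope_def_field, div_le_iff₀ (by linarith)] at h1
    linarith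

theorem re_inner_cfc_nonneg_aux
    {E : Type*} [NormedAddCommGroup E] [InnerProductSpace ℂ E] [CompleteSpace E]
    (T : E →L[ℂ] E) (g : ℝ → ℝ) (hg : ∀ t ∈ spectrum ℝ T, 0 ≤ g t) (x : E) :
    0 ≤ RCLike.re ⟪(cfc g T) x, x⟫_ℂ := by
  have h : 0 ≤ cfc g T := cfc_nonneg hg
  rw [ContinuousLinearMap.nonneg_iff_isPositive] at h
  exact h.re_inner_nonneg_left x

theorem re_inner_cfc_comb_aux
    {E : Type*} [NormedAddCommGroup E] [InnerProductSpace ℂ E] [CompleteSpace E]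
    (T : E →L[ℂ] E) (hT : IsSelfAdjoint T) (g h : ℝ → ℝ) (a b : ℝ)
    (hg : ContinuousOn g (spectrum ℝ T)) (hh : ContinuousOn h (spectrum ℝ T))
    (x : E) (hx : ‖x‖ = 1) :
    RCLike.re ⟪(cfc (fun t => g t + a * h t + b) T) x, x⟫_ℂ =
      RCLike.re ⟪(cfc g T) x, x⟫_ℂ + a * RCLike.re ⟪(cfc h T) x, x⟫_ℂ + b := by
  rw [cfc_add (a := T) (fun t => g t + a * h t) (fun _ => b) (by fun_prop) (by fun_prop),
    cfc_add (a := T) g (fun t => a * h t) (by fun_prop) (by fun_prop),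
    cfc_const_mul a h T hh, cfc_const b T hT]
  have e1 : (algebraMap ℝ (E →L[ℂ] E) b) x = (b : ℂ) • x := by
    rw [Algebra.algebraMap_eq_smul_one]; simp
  have e2 : (a • cfc h T) x = (a : ℂ) • (cfc h T x) := by simp
  rw [ContinuousLinearMap.add_apply, ContinuousLinearMap.add_apply, e1, e2,
    inner_add_left, inner_add_left, inner_smul_left, inner_smul_left, inner_self_eq_norm_sq_to_K, hx]
  simp

theorem jensen_gradient_reverse_convex
    {E : Type*} [NormedAddCommGroup E] [InnerProductSpace ℂ E] [CompleteSpace E]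
    (T : E →L[ℂ] E) (hT : IsSelfAdjoint T) (m M : ℝ) (hmM : m < M)
    (J : Set ℝ) (hJ : J.OrdConnected)
    (f f' : ℝ → ℝ)
    (hderiv : ∀ t ∈ interior J, HasDerivAt f (f' t) t)
    (hf'_cont : ContinuousOn f' (interior J))
    (hIcc : Set.Icc m M ⊆ interior J)
    (hspec : spectrum ℝ T ⊆ Set.Icc m M)
    (hconv : ConvexOn ℝ (interior J) f)
    (x : E) (hx : ‖x‖ = 1) :
    0 ≤ RCLike.re ⟪(cfc f T) x, x⟫_ℂ - f (RCLike.re ⟪T x, x⟫_ℂ) ∧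
    RCLike.re ⟪(cfc f T) x, x⟫_ℂ - f (RCLike.re ⟪T x, x⟫_ℂ) ≤
        RCLike.re ⟪(cfc (fun t => t * f' t) T) x, x⟫_ℂ -
        RCLike.re ⟪T x, x⟫_ℂ * RCLike.re ⟪(cfc f' T) x, x⟫_ℂ := by
  have hsJ : spectrum ℝ T ⊆ interior J := hspec.trans hIcc
  have hf'c : ContinuousOn f' (spectrum ℝ T) := hf'_cont.mono hsJ
  have hfc : ContinuousOn f (spectrum ℝ T) :=
    fun t ht => (hderiv t (hsJ ht)).continuousAt.continuousWithinAt
  have hid : cfc (fun t : ℝ => t) T = T := cfc_id' ℝ T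
  have h0c : ContinuousOn (fun _ : ℝ => (0 : ℝ)) (spectrum ℝ T) := continuousOn_const
  have hic : ContinuousOn (fun t : ℝ => t) (spectrum ℝ T) := continuousOn_id
  have h0 : cfc (fun _ : ℝ => (0 : ℝ)) T = 0 := cfc_const_zero ℝ T
  have hc : RCLike.re ⟪T x, x⟫_ℂ ∈ Set.Icc m M := by
    constructor
    · have h1 := re_inner_cfc_nonneg_aux T (fun t => 0 + 1 * t + (-m))
        (fun t ht => by have := (hspec ht).1; linarith) x
      rw [re_inner_cfc_comb_aux T hT (fun _ => 0) (fun t => t) 1 (-m) h0c hic x hx, hid, h0] at h1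
      simp at h1 ⊢
      linarith
    · have h1 := re_inner_cfc_nonneg_aux T (fun t => 0 + (-1) * t + M)
        (fun t ht => by have := (hspec ht).2; linarith) x
      rw [re_inner_cfc_comb_aux T hT (fun _ => 0) (fun t => t) (-1) M h0c hic x hx, hid, h0] at h1
      simp at h1 ⊢
      linarith
  generalize hcdef : RCLike.re ⟪T x, x⟫_ℂ = c at hc ⊢
  have hcJ := hIcc hc
  constructor
  · have h1 := re_inner_cfc_nonneg_aux T (fun t => f t + (-f' c) * t + (f' c * c - f c))
      (fun t ht => by
        have := tangent_le_aux hconv hcJ (hsJ ht) (hderiv c hcJ)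
        linarith) x
    rw [re_inner_cfc_comb_aux T hT f (fun t => t) _ _ hfc hic x hx, hid, hcdef] at h1
    linarith
  · have h1 := re_inner_cfc_nonneg_aux T
      (fun t => (t * f' t + (-c) * f' t + 0) + (-1) * f t + f c)
      (fun t ht => by
        have := tangent_le_aux hconv (hsJ ht) hcJ (hderiv t (hsJ ht))
        linarith) x
    rw [re_inner_cfc_comb_aux T hT (fun t => t * f' t + (-c) * f' t + 0) f _ _
      (by fun_prop) hfc x hx,
      re_inner_cfc_comb_aux T hT (fun t => t * f' t) f' _ _ (by fun_prop) hf'c x hx] at h1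
    linarith
end

section
/- Let J be an interval and f : J → (0, ∞) a differentiable function on the interior of J whose derivative f′ is continuous there, and suppose σ(T) ⊆ [m, M] ⊂ interior of J. If f is log-convex on the interior of J, then for every unit vector x ∈ E, 1 ≤ exp ⟨(ln∘f)(T) x, x⟩ / f(⟨Tx, x⟩) ≤ exp [ ⟨(t ↦ t·f′(t)/f(t))(T) x, x⟩ − ⟨Tx, x⟩ · ⟨(t ↦ f′(t)/f(t))(T) x, x⟩ ]. -/
open scoped InnerProductSpace

section helpers

lemma real_inner_smul_left_aux {E : Type*} [NormedAddCommGroup E] [InnerProductSpace ℂ E]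
    (r : ℝ) (y x : E) : RCLike.re ⟪r • y, x⟫_ℂ = r * RCLike.re ⟪y, x⟫_ℂ := by
  rw [← Complex.coe_smul, inner_smul_left]
  simp

lemma tangent_aux {S : Set ℝ} {g : ℝ → ℝ} (hg : ConvexOn ℝ S g) {s t d : ℝ} (hs : s ∈ S)
    (ht : t ∈ S) (hd : HasDerivAt g d s) : g s + d * (t - s) ≤ g t := by
  rcases lt_trichotomy s t with h | h | h
  · have := hg.le_slope_of_hasDerivAt hs ht h hd
    rw [slope_def_field, le_div_iff₀ (by linarith)] at this
    linarith
  · subst h; simp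
  · have := hg.slope_le_of_hasDerivAt ht hs h hd
    rw [slope_def_field, div_le_iff₀ (by linarith)] at this
    linarith

variable {E : Type*} [NormedAddCommGroup E] [InnerProductSpace ℂ E] [CompleteSpace E]

lemma cfc_inner_mono (T : E →L[ℂ] E) (x : E) (g h : ℝ → ℝ)
    (hg : ContinuousOn g (spectrum ℝ T)) (hh : ContinuousOn h (spectrum ℝ T))
    (hle : ∀ t ∈ spectrum ℝ T, g t ≤ h t) :
    RCLike.re ⟪(cfc g T) x, x⟫_ℂ ≤ RCLike.re ⟪(cfc h T) x, x⟫_ℂ := by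
  have h1 : cfc g T ≤ cfc h T := cfc_mono hle hg hh
  rw [ContinuousLinearMap.le_def] at h1
  have := h1.re_inner_nonneg_left x
  rw [ContinuousLinearMap.sub_apply, inner_sub_left, map_sub] at this
  linarith

lemma cfc_inner_add (T : E →L[ℂ] E) (x : E) (g h : ℝ → ℝ)
    (hg : ContinuousOn g (spectrum ℝ T)) (hh : ContinuousOn h (spectrum ℝ T)) :
    RCLike.re ⟪(cfc (fun t => g t + h t) T) x, x⟫_ℂ =
      RCLike.re ⟪(cfc g T) x, x⟫_ℂ + RCLike.re ⟪(cfc h T) x, x⟫_ℂ := by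
  rw [cfc_add (a := T) g h hg hh, ContinuousLinearMap.add_apply, inner_add_left, map_add]

lemma cfc_inner_smul (T : E →L[ℂ] E) (x : E) (r : ℝ) (g : ℝ → ℝ)
    (hg : ContinuousOn g (spectrum ℝ T)) :
    RCLike.re ⟪(cfc (fun t => r * g t) T) x, x⟫_ℂ =
      r * RCLike.re ⟪(cfc g T) x, x⟫_ℂ := by
  rw [cfc_const_mul r g T hg, ContinuousLinearMap.smul_apply, real_inner_smul_left_aux]

lemma cfc_inner_const (T : E →L[ℂ] E) (hT : IsSelfAdjoint T) (x : E) (hx : ‖x‖ = 1) (r : ℝ) :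
    RCLike.re ⟪(cfc (fun _ => r) T) x, x⟫_ℂ = r := by
  rw [cfc_const r T hT, Algebra.algebraMap_eq_smul_one, ContinuousLinearMap.smul_apply,
    real_inner_smul_left_aux, ContinuousLinearMap.one_apply, inner_self_eq_norm_sq, hx]
  simp

end helpers

theorem jensen_gradient_reverse_log_convex
    {E : Type*} [NormedAddCommGroup E] [InnerProductSpace ℂ E] [CompleteSpace E]
    (T : E →L[ℂ] E) (hT : IsSelfAdjoint T) (m M : ℝ) (hmM : m < M)
    (J : Set ℝ) (hJ : J.OrdConnected)
    (f f' : ℝ → ℝ)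
    (hderiv : ∀ t ∈ interior J, HasDerivAt f (f' t) t)
    (hf'_cont : ContinuousOn f' (interior J))
    (hIcc : Set.Icc m M ⊆ interior J)
    (hspec : spectrum ℝ T ⊆ Set.Icc m M)
    (hf_pos : ∀ t ∈ interior J, 0 < f t)
    (hf_logconv : ConvexOn ℝ (interior J) (fun t => Real.log (f t)))
    (x : E) (hx : ‖x‖ = 1) :
    1 ≤ Real.exp (RCLike.re ⟪(cfc (fun t => Real.log (f t)) T) x, x⟫_ℂ) /
        f (RCLike.re ⟪T x, x⟫_ℂ) ∧
    Real.exp (RCLike.re ⟪(cfc (fun t => Real.log (f t)) T) x, x⟫_ℂ) /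
        f (RCLike.re ⟪T x, x⟫_ℂ) ≤
      Real.exp (RCLike.re ⟪(cfc (fun t => t * f' t / f t) T) x, x⟫_ℂ -
        RCLike.re ⟪T x, x⟫_ℂ * RCLike.re ⟪(cfc (fun t => f' t / f t) T) x, x⟫_ℂ) := by
  have hsub : spectrum ℝ T ⊆ interior J := hspec.trans hIcc
  set a : ℝ := RCLike.re ⟪T x, x⟫_ℂ with ha
  have hid : RCLike.re ⟪(cfc (fun t : ℝ => t) T) x, x⟫_ℂ = a := by rw [cfc_id' ℝ T hT]
  have hc := cfc_inner_const T hT x hx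
  have ham : m ≤ a := by
    rw [← hid, ← hc m]
    exact cfc_inner_mono T x _ _ continuousOn_const continuousOn_id fun t ht => (hspec ht).1
  have haM : a ≤ M := by
    rw [← hid, ← hc M]
    exact cfc_inner_mono T x _ _ continuousOn_id continuousOn_const fun t ht => (hspec ht).2
  have haJ : a ∈ interior J := hIcc ⟨ham, haM⟩
  have hfa := hf_pos a haJ
  have hgd : ∀ t ∈ interior J, HasDerivAt (fun t => Real.log (f t)) (f' t / f t) t :=
    fun t ht => (hderiv t ht).log (hf_pos t ht).ne'
  have hgc : ContinuousOn (fun t => Real.log (f t)) (spectrum ℝ T) :=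
    fun t ht => (hgd t (hsub ht)).continuousAt.continuousWithinAt
  have hfc : ContinuousOn f (spectrum ℝ T) :=
    fun t ht => (hderiv t (hsub ht)).continuousAt.continuousWithinAt
  have hdc : ContinuousOn (fun t => f' t / f t) (spectrum ℝ T) :=
    (hf'_cont.mono hsub).div hfc fun t ht => (hf_pos t (hsub ht)).ne'
  have htdc : ContinuousOn (fun t => t * f' t / f t) (spectrum ℝ T) :=
    (continuousOn_id.mul (hf'_cont.mono hsub)).div hfc fun t ht => (hf_pos t (hsub ht)).ne'
  have hidc : ContinuousOn (fun t : ℝ => t) (spectrum ℝ T) := continuousOn_id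
  have low : Real.log (f a) ≤ RCLike.re ⟪(cfc (fun t => Real.log (f t)) T) x, x⟫_ℂ := by
    have h1 := cfc_inner_mono T x
      (fun t => (Real.log (f a) - f' a / f a * a) + (f' a / f a) * t)
      (fun t => Real.log (f t)) (continuousOn_const.add (continuousOn_const.mul hidc)) hgc
      (fun t ht => by
        have := tangent_aux hf_logconv haJ (hsub ht) (hgd a haJ)
        linarith)
    rw [cfc_inner_add T x (fun _ => Real.log (f a) - f' a / f a * a) (fun t => (f' a / f a) * t)
      continuousOn_const (continuousOn_const.mul hidc), hc,
      cfc_inner_smul T x (f' a / f a) (fun t => t) hidc, hid] at h1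
    linarith
  have up : RCLike.re ⟪(cfc (fun t => Real.log (f t)) T) x, x⟫_ℂ ≤
      Real.log (f a) + (RCLike.re ⟪(cfc (fun t => t * f' t / f t) T) x, x⟫_ℂ
        + (-a) * RCLike.re ⟪(cfc (fun t => f' t / f t) T) x, x⟫_ℂ) := by
    have hmc : ContinuousOn (fun t => (-a) * (f' t / f t)) (spectrum ℝ T) :=
      continuousOn_const.mul hdc
    have h1 := cfc_inner_mono T x (fun t => Real.log (f t))
      (fun t => Real.log (f a) + (t * f' t / f t + (-a) * (f' t / f t)))
      hgc (continuousOn_const.add (htdc.add hmc))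
      (fun t ht => by
        have := tangent_aux hf_logconv (hsub ht) haJ (hgd t (hsub ht))
        have e : t * f' t / f t = t * (f' t / f t) := by ring
        rw [e]
        linarith)
    rwa [cfc_inner_add T x (fun _ => Real.log (f a))
        (fun t => t * f' t / f t + (-a) * (f' t / f t)) continuousOn_const (htdc.add hmc), hc,
      cfc_inner_add T x (fun t => t * f' t / f t) (fun t => (-a) * (f' t / f t)) htdc hmc,
      cfc_inner_smul T x (-a) (fun t => f' t / f t) hdc] at h1
  constructor
  · rw [le_div_iff₀ hfa, one_mul, ← Real.log_le_iff_le_exp hfa]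
    exact low
  · have hexp : f a = Real.exp (Real.log (f a)) := (Real.exp_log hfa).symm
    rw [hexp, ← Real.exp_sub, Real.exp_le_exp]
    linarith
end

section
/- Let T be positive and invertible with σ(T) ⊆ [m, M] and 0 < m < M, and let r > 0. Then for every unit vector x ∈ E, ⟨Tx, x⟩^r · exp ⟨(t ↦ ln(t^{−r}))(T) x, x⟩ ≤ exp [ r·(⟨Tx, x⟩ · ⟨T^{−1} x, x⟩ − 1) ]. -/
open scoped InnerProductSpace

theorem jensen_gradient_reverse_neg_power
    {E : Type*} [NormedAddCommGroup E] [InnerProductSpace ℂ E] [CompleteSpace E]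
    (T : E →L[ℂ] E) (hT : IsSelfAdjoint T) (m M : ℝ) (h0m : 0 < m) (hmM : m < M)
    (hspec : spectrum ℝ T ⊆ Set.Icc m M)
    (hpos : ∀ y : E, 0 ≤ RCLike.re ⟪T y, y⟫_ℂ) (hinv : IsUnit T)
    (r : ℝ) (hr : 0 < r)
    (x : E) (hx : ‖x‖ = 1) :
    (RCLike.re ⟪T x, x⟫_ℂ) ^ r *
      Real.exp (RCLike.re ⟪(cfc (fun t : ℝ => Real.log (t ^ (-r))) T) x, x⟫_ℂ) ≤
    Real.exp (r * (RCLike.re ⟪T x, x⟫_ℂ *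
      RCLike.re ⟪(cfc (fun t : ℝ => t ^ (-1 : ℝ)) T) x, x⟫_ℂ - 1)) := by
  have hposT : ∀ t ∈ spectrum ℝ T, 0 < t := fun t ht => lt_of_lt_of_le h0m (hspec ht).1
  have ha0 := hpos x
  set a : ℝ := RCLike.re ⟪T x, x⟫_ℂ with ha
  rcases ha0.eq_or_lt with h | hapos
  · rw [← h, Real.zero_rpow hr.ne', zero_mul]
    exact (Real.exp_pos _).le
  have hc1 : ContinuousOn (fun t : ℝ => Real.log (t ^ (-r))) (spectrum ℝ T) := by
    apply ContinuousOn.log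
    · exact fun t ht => (Real.continuousAt_rpow_const t (-r)
        (Or.inl (hposT t ht).ne')).continuousWithinAt
    · exact fun t ht => (Real.rpow_pos_of_pos (hposT t ht) _).ne'
  have hc2 : ContinuousOn (fun t : ℝ => t ^ (-1 : ℝ)) (spectrum ℝ T) :=
    fun t ht => (Real.continuousAt_rpow_const t (-1)
        (Or.inl (hposT t ht).ne')).continuousWithinAt
  have hle : cfc (fun t : ℝ => Real.log (t ^ (-r))) T ≤
      cfc (fun t : ℝ => (r * a) * t ^ (-1 : ℝ) + (-r - r * Real.log a)) T := by
    apply cfc_mono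
    · intro t ht
      have htp := hposT t ht
      have h1 := Real.log_le_sub_one_of_pos (div_pos hapos htp)
      rw [Real.log_div hapos.ne' htp.ne'] at h1
      have h2 := mul_le_mul_of_nonneg_left h1 hr.le
      simp only [Real.log_rpow htp, Real.rpow_neg_one]
      rw [div_eq_mul_inv] at h2
      linarith
    · exact hc1
    · exact (continuousOn_const.mul hc2).add continuousOn_const
  rw [cfc_add (a := T) (fun t : ℝ => (r * a) * t ^ (-1 : ℝ)) (fun _ => -r - r * Real.log a)
      (continuousOn_const.mul hc2) continuousOn_const,
    cfc_const_mul (r * a) (fun t : ℝ => t ^ (-1 : ℝ)) T hc2,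
    cfc_const _ T hT, ContinuousLinearMap.le_def] at hle
  have h3 := hle.re_inner_nonneg_left x
  set L := cfc (fun t : ℝ => Real.log (t ^ (-r))) T
  set S := cfc (fun t : ℝ => t ^ (-1 : ℝ)) T
  have hxx : ⟪x, x⟫_ℂ = 1 := by
    rw [inner_self_eq_norm_sq_to_K, hx]; simp
  have h4 : RCLike.re ⟪L x, x⟫_ℂ ≤
      r * a * RCLike.re ⟪S x, x⟫_ℂ + (-r - r * Real.log a) := by
    have e : ((r * a) • S + algebraMap ℝ (E →L[ℂ] E) (-r - r * Real.log a) - L) x =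
        ((r * a : ℝ) : ℂ) • S x + ((-r - r * Real.log a : ℝ) : ℂ) • x - L x := by
      rw [Algebra.algebraMap_eq_smul_one]
      simp only [ContinuousLinearMap.sub_apply, ContinuousLinearMap.add_apply,
        ContinuousLinearMap.smul_apply, ContinuousLinearMap.one_apply, Complex.coe_smul]
    rw [e, inner_sub_left, inner_add_left, inner_smul_left, inner_smul_left, hxx,
      Complex.conj_ofReal, Complex.conj_ofReal, mul_one] at h3
    simp only [RCLike.re_to_complex, Complex.sub_re, Complex.add_re, Complex.re_ofReal_mul,
      Complex.ofReal_re] at h3 ⊢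
    linarith
  rw [Real.rpow_def_of_pos hapos, ← Real.exp_add]
  apply Real.exp_le_exp.mpr
  linarith
end

section
/- Let J be an interval and f : J → (0, ∞) a log-convex differentiable function on the interior of J whose derivative f′ is continuous there, and suppose σ(T) ⊆ [m, M] ⊂ interior of J. Then for every unit vector x ∈ E, writing a = ⟨Tx, x⟩: 1 ≤ ⟨(t ↦ exp[(f′(a)/f(a))·(t − a)])(T) x, x⟩ ≤ ⟨f(T) x, x⟩ / f(a) ≤ ⟨(t ↦ exp[(f′(t)/f(t))·(t − a)])(T) x, x⟩. -/
open scoped InnerProductSpace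

lemma aux_mono {E : Type*} [NormedAddCommGroup E] [InnerProductSpace ℂ E] [CompleteSpace E]
    (T : E →L[ℂ] E) (g h : ℝ → ℝ)
    (hg : ContinuousOn g (spectrum ℝ T)) (hh : ContinuousOn h (spectrum ℝ T))
    (hgh : ∀ t ∈ spectrum ℝ T, g t ≤ h t) (x : E) :
    RCLike.re ⟪(cfc g T) x, x⟫_ℂ ≤ RCLike.re ⟪(cfc h T) x, x⟫_ℂ := by
  have h1 : cfc g T ≤ cfc h T := cfc_mono hgh hg hh
  rw [ContinuousLinearMap.le_def] at h1
  have h2 := h1.re_inner_nonneg_left x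
  rw [ContinuousLinearMap.sub_apply, inner_sub_left, map_sub] at h2
  linarith

lemma aux_affine {E : Type*} [NormedAddCommGroup E] [InnerProductSpace ℂ E] [CompleteSpace E]
    (T : E →L[ℂ] E) (hT : IsSelfAdjoint T) (c d : ℝ) (x : E) (hx : ‖x‖ = 1) :
    RCLike.re ⟪(cfc (fun t : ℝ => c * t + d) T) x, x⟫_ℂ
      = c * RCLike.re ⟪T x, x⟫_ℂ + d := by
  rw [cfc_add_const d (fun t : ℝ => c * t) T, cfc_const_mul_id c T,
    ContinuousLinearMap.add_apply, inner_add_left, map_add, Algebra.algebraMap_eq_smul_one]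
  have e : ∀ (r : ℝ) (y : E), RCLike.re ⟪r • y, x⟫_ℂ = r * RCLike.re ⟪y, x⟫_ℂ := by
    intro r y
    rw [← Complex.coe_smul, inner_smul_left]
    simp
  rw [ContinuousLinearMap.smul_apply, ContinuousLinearMap.smul_apply, e, e,
    ContinuousLinearMap.one_apply, inner_self_eq_norm_sq, hx]
  ring

lemma aux_tangent {S : Set ℝ} {g : ℝ → ℝ} (hg : ConvexOn ℝ S g) {s t g' : ℝ}
    (hs : s ∈ S) (ht : t ∈ S) (hd : HasDerivAt g g' s) : g' * (t - s) ≤ g t - g s := by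
  rcases lt_trichotomy s t with h | h | h
  · have := hg.le_slope_of_hasDerivAt hs ht h hd
    rwa [slope_def_field, le_div_iff₀ (by linarith)] at this
  · subst h; simp
  · have := hg.slope_le_of_hasDerivAt ht hs h hd
    rw [slope_def_field, div_le_iff₀ (by linarith)] at this
    linarith

theorem multiplicative_jensen_refinement_reverse
    {E : Type*} [NormedAddCommGroup E] [InnerProductSpace ℂ E] [CompleteSpace E]
    (T : E →L[ℂ] E) (hT : IsSelfAdjoint T) (m M : ℝ) (hmM : m < M)
    (J : Set ℝ) (hJ : J.OrdConnected)
    (f f' : ℝ → ℝ)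
    (hderiv : ∀ t ∈ interior J, HasDerivAt f (f' t) t)
    (hf'_cont : ContinuousOn f' (interior J))
    (hIcc : Set.Icc m M ⊆ interior J)
    (hspec : spectrum ℝ T ⊆ Set.Icc m M)
    (hf_pos : ∀ t ∈ interior J, 0 < f t)
    (hf_logconv : ConvexOn ℝ (interior J) (fun t => Real.log (f t)))
    (x : E) (hx : ‖x‖ = 1) (a : ℝ) (ha : a = RCLike.re ⟪T x, x⟫_ℂ) :
    1 ≤ RCLike.re ⟪(cfc (fun t => Real.exp ((f' a / f a) * (t - a))) T) x, x⟫_ℂ ∧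
    RCLike.re ⟪(cfc (fun t => Real.exp ((f' a / f a) * (t - a))) T) x, x⟫_ℂ ≤
        RCLike.re ⟪(cfc f T) x, x⟫_ℂ / f a ∧
    RCLike.re ⟪(cfc f T) x, x⟫_ℂ / f a ≤
        RCLike.re ⟪(cfc (fun t => Real.exp ((f' t / f t) * (t - a))) T) x, x⟫_ℂ := by
  have hS : spectrum ℝ T ⊆ interior J := hspec.trans hIcc
  have hfc : ContinuousOn f (interior J) :=
    fun t ht => (hderiv t ht).continuousAt.continuousWithinAt
  have haI : a ∈ Set.Icc m M := by
    have hid := aux_affine T hT 1 0 x hx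
    have hm := aux_affine T hT 0 m x hx
    have hM := aux_affine T hT 0 M x hx
    have h1 := aux_mono T (fun t => 0 * t + m) (fun t => 1 * t + 0) (by fun_prop) (by fun_prop)
      (fun t ht => by have := (hspec ht).1; simpa using this) x
    have h2 := aux_mono T (fun t => 1 * t + 0) (fun t => 0 * t + M) (by fun_prop) (by fun_prop)
      (fun t ht => by have := (hspec ht).2; simpa using this) x
    constructor <;> linarith
  have haJ := hIcc haI
  have hfa := hf_pos a haJ
  have htan : ∀ s ∈ interior J, ∀ t ∈ interior J,
      f' s / f s * (t - s) ≤ Real.log (f t) - Real.log (f s) := fun s hs t ht =>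
    aux_tangent hf_logconv hs ht ((hderiv s hs).log (hf_pos s hs).ne')
  have hdiv : RCLike.re ⟪(cfc f T) x, x⟫_ℂ / f a
      = RCLike.re ⟪(cfc (fun t => (f a)⁻¹ * f t) T) x, x⟫_ℂ := by
    rw [cfc_const_mul (f a)⁻¹ f T (hfc.mono hS), ContinuousLinearMap.smul_apply,
      ← Complex.coe_smul, inner_smul_left]
    simp [div_eq_inv_mul]
    left
    field_simp
  have hquot : ∀ t ∈ interior J,
      (f a)⁻¹ * f t = Real.exp (Real.log (f t) - Real.log (f a)) := fun t ht => by
    rw [Real.exp_sub, Real.exp_log (hf_pos t ht), Real.exp_log hfa, div_eq_inv_mul]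
  have hqc : ContinuousOn (fun t => (f a)⁻¹ * f t) (spectrum ℝ T) :=
    continuousOn_const.mul (hfc.mono hS)
  refine ⟨?_, ?_, ?_⟩
  · have h0 := aux_affine T hT (f' a / f a) (1 - f' a / f a * a) x hx
    rw [← ha] at h0
    have h1 := aux_mono T (fun t => f' a / f a * t + (1 - f' a / f a * a))
      (fun t => Real.exp ((f' a / f a) * (t - a))) (by fun_prop) (by fun_prop)
      (fun t _ => by
        have := Real.add_one_le_exp ((f' a / f a) * (t - a))
        linarith) x
    linarith
  · rw [hdiv]
    refine aux_mono T _ _ (by fun_prop) hqc (fun t ht => ?_) x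
    rw [hquot t (hS ht)]
    exact Real.exp_le_exp.2 (htan a haJ t (hS ht))
  · rw [hdiv]
    refine aux_mono T _ _ hqc ?_ (fun t ht => ?_) x
    · exact Real.continuous_exp.comp_continuousOn
        ((((hf'_cont.mono hS).div (hfc.mono hS) (fun t ht => (hf_pos t (hS ht)).ne'))).mul
          (by fun_prop))
    · rw [hquot t (hS ht)]
      have := htan t (hS ht) a haJ
      exact Real.exp_le_exp.2 (by linarith)
end

section
/- (Ky Fan's inequality) Let n ∈ ℕ, let p₁, …, pₙ > 0 with ∑_{i=1}^n p_i = 1, and let t₁, …, tₙ ∈ (0, 1/2). Then (1 − ∑_{i=1}^n p_i t_i) / (∑_{i=1}^n p_i t_i) ≤ ∏_{i=1}^n ((1 − t_i)/t_i)^{p_i}. -/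
theorem ky_fan_convex_aux :
    ConvexOn ℝ (Set.Ioo (0 : ℝ) (1 / 2)) (fun x : ℝ => Real.log (1 - x) - Real.log x) := by
  have hd : ∀ x ∈ Set.Ioo (0 : ℝ) (1 / 2),
      HasDerivAt (fun x : ℝ => Real.log (1 - x) - Real.log x) (-(1 / (x * (1 - x)))) x := by
    intro x hx
    have h0 : x ≠ 0 := hx.1.ne'
    have h1 : 1 - x ≠ 0 := by linarith [hx.2]
    have h := (((hasDerivAt_id x).const_sub 1).log h1).sub (Real.hasDerivAt_log h0)
    refine h.congr_deriv ?_
    simp only [id]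
    field_simp
    ring
  apply MonotoneOn.convexOn_of_deriv (convex_Ioo _ _)
  · exact fun x hx => (hd x hx).continuousAt.continuousWithinAt
  · rw [interior_Ioo]
    exact fun x hx => (hd x hx).differentiableAt.differentiableWithinAt
  · rw [interior_Ioo]
    intro x hx y hy hxy
    rw [(hd x hx).deriv, (hd y hy).deriv]
    obtain ⟨hx0, hx1⟩ := hx
    obtain ⟨hy0, hy1⟩ := hy
    apply neg_le_neg
    apply one_div_le_one_div_of_le
    · exact mul_pos hx0 (by linarith)
    · nlinarith

theorem ky_fan_inequality (n : ℕ) (p t : Fin n → ℝ)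
    (hp : ∀ i, 0 < p i) (hp1 : ∑ i, p i = 1)
    (ht : ∀ i, t i ∈ Set.Ioo (0 : ℝ) (1 / 2)) :
    (1 - ∑ i, p i * t i) / (∑ i, p i * t i) ≤
      ∏ i, ((1 - t i) / t i) ^ (p i) := by
  have hm : ∑ i, p i * t i ∈ Set.Ioo (0 : ℝ) (1 / 2) :=
    (convex_Ioo (0 : ℝ) (1 / 2)).sum_mem (fun i _ => (hp i).le) hp1 (fun i _ => ht i)
  have hJ := ky_fan_convex_aux.map_sum_le (t := Finset.univ) (w := p) (p := t)
    (fun i _ => (hp i).le) hp1 (fun i _ => ht i)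
  simp only [smul_eq_mul] at hJ
  have hq : ∀ x ∈ Set.Ioo (0 : ℝ) (1 / 2), 0 < (1 - x) / x := fun x hx =>
    div_pos (by linarith [hx.2]) hx.1
  have hl : ∀ x ∈ Set.Ioo (0 : ℝ) (1 / 2),
      Real.log ((1 - x) / x) = Real.log (1 - x) - Real.log x := fun x hx =>
    Real.log_div (by linarith [hx.2]) hx.1.ne'
  have hpos : ∀ i, 0 < ((1 - t i) / t i) ^ (p i) := fun i => Real.rpow_pos_of_pos (hq _ (ht i)) _
  rw [← Real.log_le_log_iff (hq _ hm) (Finset.prod_pos fun i _ => hpos i), hl _ hm,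
    Real.log_prod (fun i _ => (hpos i).ne')]
  refine hJ.trans (le_of_eq (Finset.sum_congr rfl fun i _ => ?_))
  rw [Real.log_rpow (hq _ (ht i)), hl _ (ht i)]
end

section
/- Let T be positive and invertible with σ(T) ⊆ [m, M] ⊂ (0, 1/2) where 0 < m < M, and let r > 0. Then for every unit vector x ∈ E, ⟨(t ↦ ((1−t)/t)^r)(T) x, x⟩ ≥ exp ⟨(t ↦ ln(((1−t)/t)^r))(T) x, x⟩ ≥ ( ⟨(I−T) x, x⟩ · ⟨Tx, x⟩^{−1} )^r. -/
open scoped InnerProductSpace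

lemma phi_affine_le {E : Type*} [NormedAddCommGroup E] [InnerProductSpace ℂ E] [CompleteSpace E]
    (T : E →L[ℂ] E) (hT : IsSelfAdjoint T) (f g : ℝ → ℝ) (a b : ℝ)
    (hf : ContinuousOn f (spectrum ℝ T)) (hg : ContinuousOn g (spectrum ℝ T))
    (h : ∀ t ∈ spectrum ℝ T, a + b * f t ≤ g t) (x : E) (hx : ‖x‖ = 1) :
    a + b * RCLike.re ⟪(cfc f T) x, x⟫_ℂ ≤ RCLike.re ⟪(cfc g T) x, x⟫_ℂ := by
  have h1 : cfc (fun t => a + b * f t) T ≤ cfc g T :=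
    cfc_mono h (by fun_prop) hg
  have h2 : cfc (fun t => a + b * f t) T = algebraMap ℝ (E →L[ℂ] E) a + b • cfc f T := by
    rw [cfc_const_add a (fun t => b * f t) T (by fun_prop) hT, cfc_const_mul b f T hf]
  rw [h2, ContinuousLinearMap.le_def] at h1
  have h3 := h1.re_inner_nonneg_left x
  have e1 : (algebraMap ℝ (E →L[ℂ] E) a) x = (a : ℂ) • x := by
    rw [Algebra.algebraMap_eq_smul_one]; simp
  have e2 : (b • cfc f T) x = (b : ℂ) • (cfc f T x) := by simp
  rw [ContinuousLinearMap.sub_apply, ContinuousLinearMap.add_apply, e1, e2, inner_sub_left,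
    inner_add_left, inner_smul_left, inner_smul_left, inner_self_eq_norm_sq_to_K, hx] at h3
  simp at h3 ⊢
  linarith

lemma tangent_ineq (c t : ℝ) (hc : 0 < c) (hc2 : c < 1 / 2) (ht : 0 < t) (ht2 : t < 1 / 2) :
    Real.log ((1 - c) / c) - (t - c) / (c * (1 - c)) ≤ Real.log ((1 - t) / t) := by
  have hd : ∀ u : ℝ, 0 < u → u < 1 / 2 →
      HasDerivAt (fun u : ℝ => Real.log ((1 - u) / u)) (-(1 / (u * (1 - u)))) u := by
    intro u hu hu2
    have h1 : (1 - u) ≠ 0 := by linarith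
    have := (((hasDerivAt_id u).const_sub 1).div (hasDerivAt_id u) hu.ne').log
      (div_ne_zero h1 hu.ne')
    refine this.congr_deriv ?_
    simp
    field_simp
    ring
  have hcc : 0 < c * (1 - c) := mul_pos hc (by linarith)
  rcases lt_trichotomy t c with h | h | h
  · obtain ⟨u, ⟨hu1, hu2⟩, hu⟩ := exists_hasDerivAt_eq_slope
      (fun u : ℝ => Real.log ((1 - u) / u)) (fun u => -(1 / (u * (1 - u)))) h
      (fun v hv => (hd v (by linarith [hv.1]) (by linarith [hv.2])).continuousAt.continuousWithinAt)
      (fun v hv => hd v (by linarith [hv.1]) (by linarith [hv.2]))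
    have huu : 0 < u * (1 - u) := mul_pos (by linarith) (by linarith)
    have hle : 1 / (c * (1 - c)) ≤ 1 / (u * (1 - u)) :=
      one_div_le_one_div_of_le huu (by nlinarith)
    rw [eq_div_iff (by linarith)] at hu
    have := mul_le_mul_of_nonneg_right hle (by linarith : 0 ≤ c - t)
    have e : (t - c) / (c * (1 - c)) = - (1 / (c * (1 - c)) * (c - t)) := by ring
    rw [e]; linarith
  · simp [h]
  · obtain ⟨u, ⟨hu1, hu2⟩, hu⟩ := exists_hasDerivAt_eq_slope
      (fun u : ℝ => Real.log ((1 - u) / u)) (fun u => -(1 / (u * (1 - u)))) h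
      (fun v hv => (hd v (by linarith [hv.1]) (by linarith [hv.2])).continuousAt.continuousWithinAt)
      (fun v hv => hd v (by linarith [hv.1]) (by linarith [hv.2]))
    have hle : 1 / (u * (1 - u)) ≤ 1 / (c * (1 - c)) :=
      one_div_le_one_div_of_le hcc (by nlinarith)
    rw [eq_div_iff (by linarith)] at hu
    have := mul_le_mul_of_nonneg_right hle (by linarith : 0 ≤ t - c)
    have e : (t - c) / (c * (1 - c)) = (1 / (c * (1 - c)) * (t - c)) := by ring
    rw [e]; linarith

theorem mond_pecaric_ky_fan_function
    {E : Type*} [NormedAddCommGroup E] [InnerProductSpace ℂ E] [CompleteSpace E]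
    (T : E →L[ℂ] E) (hT : IsSelfAdjoint T) (m M : ℝ) (h0m : 0 < m) (hmM : m < M)
    (hM : M < 1 / 2)
    (hspec : spectrum ℝ T ⊆ Set.Icc m M)
    (hpos : ∀ y : E, 0 ≤ RCLike.re ⟪T y, y⟫_ℂ) (hinv : IsUnit T)
    (r : ℝ) (hr : 0 < r)
    (x : E) (hx : ‖x‖ = 1) :
    RCLike.re ⟪(cfc (fun t : ℝ => ((1 - t) / t) ^ r) T) x, x⟫_ℂ ≥
      Real.exp (RCLike.re ⟪(cfc (fun t : ℝ => Real.log (((1 - t) / t) ^ r)) T) x, x⟫_ℂ) ∧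
    Real.exp (RCLike.re ⟪(cfc (fun t : ℝ => Real.log (((1 - t) / t) ^ r)) T) x, x⟫_ℂ) ≥
      (RCLike.re ⟪((1 : E →L[ℂ] E) - T) x, x⟫_ℂ * (RCLike.re ⟪T x, x⟫_ℂ)⁻¹) ^ r := by
  have hq : ∀ t ∈ spectrum ℝ T, 0 < (1 - t) / t := fun t ht =>
    div_pos (by linarith [(hspec ht).2]) (by linarith [(hspec ht).1])
  have hg : ContinuousOn (fun t : ℝ => ((1 - t) / t) ^ r) (spectrum ℝ T) := by
    refine ContinuousOn.rpow_const ?_ (fun t ht => Or.inl (hq t ht).ne')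
    exact (by fun_prop : ContinuousOn (fun t : ℝ => 1 - t) _).div continuousOn_id
      (fun t ht => by have := (hspec ht).1; simp; linarith)
  have hl : ContinuousOn (fun t : ℝ => Real.log (((1 - t) / t) ^ r)) (spectrum ℝ T) :=
    hg.log (fun t ht => (Real.rpow_pos_of_pos (hq t ht) r).ne')
  have hid : cfc (fun t : ℝ => t) T = T := cfc_id' ℝ T
  have hic : ContinuousOn (fun t : ℝ => t) (spectrum ℝ T) := continuousOn_id
  have hcm := phi_affine_le T hT (fun t => t) (fun t => t) m 0 hic hic
    (fun t ht => by have := (hspec ht).1; simpa using this) x hx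
  have hcM := phi_affine_le T hT (fun t => t) (fun _ => 0) (-M) 1 hic continuousOn_const
    (fun t ht => by have := (hspec ht).2; simp; linarith) x hx
  have hz : cfc (fun _ : ℝ => (0 : ℝ)) T = 0 := cfc_const_zero ℝ T
  rw [hid] at hcm
  rw [hid, hz] at hcM
  simp only [ContinuousLinearMap.zero_apply, inner_zero_left, map_zero] at hcM
  constructor
  · set s := RCLike.re ⟪(cfc (fun t : ℝ => Real.log (((1 - t) / t) ^ r)) T) x, x⟫_ℂ with hs
    have := phi_affine_le T hT _ _ (Real.exp s * (1 - s)) (Real.exp s) hl hg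
      (fun t ht => by
        have hp := Real.rpow_pos_of_pos (hq t ht) r
        set y := ((1 - t) / t) ^ r
        have h1 := Real.add_one_le_exp (Real.log y - s)
        have h2 : Real.exp s * Real.exp (Real.log y - s) = y := by
          rw [← Real.exp_add]; simp [Real.exp_log hp]
        have h3 := mul_le_mul_of_nonneg_left h1 (Real.exp_pos s).le
        show Real.exp s * (1 - s) + Real.exp s * Real.log y ≤ y
        linarith) x hx
    rw [← hs] at this
    linarith
  · have e : RCLike.re ⟪((1 : E →L[ℂ] E) - T) x, x⟫_ℂ = 1 - RCLike.re ⟪T x, x⟫_ℂ := by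
      rw [ContinuousLinearMap.sub_apply, inner_sub_left, ContinuousLinearMap.one_apply,
        inner_self_eq_norm_sq_to_K, hx]
      simp
    rw [e]
    set c := RCLike.re ⟪T x, x⟫_ℂ with hc
    have hc0 : 0 < c := by linarith
    have hc2 : c < 1 / 2 := by linarith
    have hcq : 0 < (1 - c) / c := div_pos (by linarith) hc0
    have := phi_affine_le T hT (fun t => t) _ (r * (Real.log ((1 - c) / c) + c / (c * (1 - c))))
      (- (r / (c * (1 - c)))) hic hl
      (fun t ht => by
        have h1 := tangent_ineq c t hc0 hc2 (by linarith [(hspec ht).1]) (by linarith [(hspec ht).2])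
        have h2 := mul_le_mul_of_nonneg_left h1 hr.le
        show _ ≤ Real.log (((1 - t) / t) ^ r)
        rw [Real.log_rpow (hq t ht)]
        refine le_trans (le_of_eq ?_) h2
        ring) x hx
    rw [hid, ← hc] at this
    rw [← div_eq_mul_inv, Real.rpow_def_of_pos hcq]
    apply Real.exp_le_exp.mpr
    refine le_trans (le_of_eq ?_) this
    ring
end

section
/- Let T be positive and invertible with σ(T) ⊆ [m, M] ⊂ (0, 1/2) where 0 < m < M, and let r > 0. Then for every unit vector x ∈ E, writing a = ⟨Tx, x⟩: (i) 1 ≤ exp ⟨(t ↦ ln(((1−t)/t)^r))(T) x, x⟩ / ((1−a)·a^{−1})^r ≤ exp[ r·( a·⟨(t ↦ 1/(t(1−t)))(T) x, x⟩ − ⟨(t ↦ 1/(1−t))(T) x, x⟩ ) ]; and (ii) 1 ≤ ⟨(t ↦ exp[ r·(1−a)^{−1}·(1 − t/a) ])(T) x, x⟩ ≤ ⟨(t ↦ ((1−t)/t)^r)(T) x, x⟩ / ((1−a)/a)^r ≤ ⟨(t ↦ exp[ r·(1−t)^{−1}·(a/t − 1) ])(T) x, x⟩. -/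
open scoped InnerProductSpace

lemma ky_grad (s t : ℝ) (hs : 0 < s) (hs' : s < 1 / 2) (ht : 0 < t) (ht' : t < 1 / 2) :
    (s - t) / (s * (1 - s)) ≤ Real.log ((1 - t) / t) - Real.log ((1 - s) / s) := by
  have hd : ∀ c : ℝ, 0 < c → c < 1 / 2 →
      HasDerivAt (fun u : ℝ => Real.log (1 - u) - Real.log u) (-(1 / (c * (1 - c)))) c := by
    intro c hc hc'
    have h1 : (1 - c) ≠ 0 := by linarith
    have h2 : HasDerivAt (fun u : ℝ => Real.log (1 - u) - Real.log u)
        (-1 / (1 - c) - 1 / c) c := (((hasDerivAt_id c).const_sub 1).log h1).sub ((hasDerivAt_id c).log hc.ne')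
    have e : -(1 / (c * (1 - c))) = -1 / (1 - c) - 1 / c := by
      have hc0 := hc.ne'
      field_simp
      ring
    rw [e]
    exact h2
  have hl : ∀ c : ℝ, 0 < c → c < 1 / 2 →
      Real.log ((1 - c) / c) = Real.log (1 - c) - Real.log c := by
    intro c hc hc'
    exact Real.log_div (by linarith) hc.ne'
  rw [hl s hs hs', hl t ht ht']
  have hsp : 0 < s * (1 - s) := by apply mul_pos <;> linarith
  rcases lt_trichotomy s t with h | h | h
  · obtain ⟨c, hc, hce⟩ := exists_hasDerivAt_eq_slope
      (fun u : ℝ => Real.log (1 - u) - Real.log u) (fun c => -(1 / (c * (1 - c)))) h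
      (fun c hc => (hd c (by linarith [hc.1]) (by linarith [hc.2])).continuousAt.continuousWithinAt)
      (fun c hc => hd c (by linarith [hc.1]) (by linarith [hc.2]))
    have hcs : s * (1 - s) ≤ c * (1 - c) := by nlinarith [hc.1, hc.2]
    have h3 := one_div_le_one_div_of_le hsp hcs
    have hts : 0 < t - s := by linarith
    rw [eq_div_iff hts.ne'] at hce
    have h4 := mul_le_mul_of_nonneg_right h3 hts.le
    have h5 : (s - t) / (s * (1 - s)) = -(1 / (s * (1 - s)) * (t - s)) := by ring
    rw [h5]; linarith
  · subst h; simp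
  · obtain ⟨c, hc, hce⟩ := exists_hasDerivAt_eq_slope
      (fun u : ℝ => Real.log (1 - u) - Real.log u) (fun c => -(1 / (c * (1 - c)))) h
      (fun c hc => (hd c (by linarith [hc.1]) (by linarith [hc.2])).continuousAt.continuousWithinAt)
      (fun c hc => hd c (by linarith [hc.1]) (by linarith [hc.2]))
    have hcs : c * (1 - c) ≤ s * (1 - s) := by nlinarith [hc.1, hc.2]
    have hcp : 0 < c * (1 - c) := by apply mul_pos <;> linarith [hc.1, hc.2]
    have h3 := one_div_le_one_div_of_le hcp hcs
    have hts : 0 < s - t := by linarith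
    rw [eq_div_iff hts.ne'] at hce
    have h4 := mul_le_mul_of_nonneg_right h3 hts.le
    have h5 : (s - t) / (s * (1 - s)) = (1 / (s * (1 - s)) * (s - t)) := by ring
    rw [h5]; linarith

theorem jensen_gradient_ky_fan_function
    {E : Type*} [NormedAddCommGroup E] [InnerProductSpace ℂ E] [CompleteSpace E]
    (T : E →L[ℂ] E) (hT : IsSelfAdjoint T) (m M : ℝ) (h0m : 0 < m) (hmM : m < M)
    (hM : M < 1 / 2)
    (hspec : spectrum ℝ T ⊆ Set.Icc m M)
    (hpos : ∀ y : E, 0 ≤ RCLike.re ⟪T y, y⟫_ℂ) (hinv : IsUnit T)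
    (r : ℝ) (hr : 0 < r)
    (x : E) (hx : ‖x‖ = 1) (a : ℝ) (ha : a = RCLike.re ⟪T x, x⟫_ℂ) :
    (1 ≤ Real.exp (RCLike.re ⟪(cfc (fun t : ℝ =>
          Real.log (((1 - t) / t) ^ r)) T) x, x⟫_ℂ) / ((1 - a) * a⁻¹) ^ r ∧
      Real.exp (RCLike.re ⟪(cfc (fun t : ℝ =>
          Real.log (((1 - t) / t) ^ r)) T) x, x⟫_ℂ) / ((1 - a) * a⁻¹) ^ r ≤
        Real.exp (r * (a * RCLike.re ⟪(cfc (fun t : ℝ => 1 / (t * (1 - t))) T) x, x⟫_ℂ -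
          RCLike.re ⟪(cfc (fun t : ℝ => 1 / (1 - t)) T) x, x⟫_ℂ))) ∧
    (1 ≤ RCLike.re ⟪(cfc (fun t : ℝ =>
          Real.exp (r * (1 - a)⁻¹ * (1 - t / a))) T) x, x⟫_ℂ ∧
      RCLike.re ⟪(cfc (fun t : ℝ =>
          Real.exp (r * (1 - a)⁻¹ * (1 - t / a))) T) x, x⟫_ℂ ≤
        RCLike.re ⟪(cfc (fun t : ℝ => ((1 - t) / t) ^ r) T) x, x⟫_ℂ / ((1 - a) / a) ^ r ∧
      RCLike.re ⟪(cfc (fun t : ℝ => ((1 - t) / t) ^ r) T) x, x⟫_ℂ / ((1 - a) / a) ^ r ≤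
        RCLike.re ⟪(cfc (fun t : ℝ =>
          Real.exp (r * (1 - t)⁻¹ * (a / t - 1))) T) x, x⟫_ℂ) := by
  have key : ∃ φ : (ℝ → ℝ) → ℝ, (∀ f, RCLike.re ⟪(cfc f T) x, x⟫_ℂ = φ f) ∧
      φ (fun _ => 1) = 1 ∧ φ (fun t => t) = a ∧
      (∀ f g : ℝ → ℝ, ContinuousOn f (spectrum ℝ T) → ContinuousOn g (spectrum ℝ T) →
        φ (fun t => f t + g t) = φ f + φ g) ∧
      (∀ (c : ℝ) (f : ℝ → ℝ), ContinuousOn f (spectrum ℝ T) →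
        φ (fun t => c * f t) = c * φ f) ∧
      (∀ f g : ℝ → ℝ, ContinuousOn f (spectrum ℝ T) → ContinuousOn g (spectrum ℝ T) →
        (∀ t ∈ spectrum ℝ T, f t ≤ g t) → φ f ≤ φ g) := by
    refine ⟨fun f => RCLike.re ⟪(cfc f T) x, x⟫_ℂ, fun f => rfl, ?_, ?_, ?_, ?_, ?_⟩
    · try simp only
      rw [cfc_const_one ℝ T, ContinuousLinearMap.one_apply, inner_self_eq_norm_sq, hx]; norm_num
    · try simp only
      rw [cfc_id' ℝ T, ha]
    · intro f g hf hg
      try simp only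
      rw [cfc_add T f g hf hg, ContinuousLinearMap.add_apply, inner_add_left, map_add]
    · intro c f hf
      try simp only
      rw [cfc_const_mul c f T hf, ContinuousLinearMap.smul_apply,
        RCLike.real_smul_eq_coe_smul (K := ℂ) c, inner_smul_left, RCLike.conj_ofReal,
        RCLike.re_ofReal_mul]
    · intro f g hf hg h
      have h1 := cfc_mono h hf hg
      rw [ContinuousLinearMap.le_def] at h1
      have h2 := h1.re_inner_nonneg_left x
      rw [ContinuousLinearMap.sub_apply, inner_sub_left, map_sub] at h2
      try simp only
      linarith
  obtain ⟨φ, hφ, φ1, φid, φadd, φmul, φmono⟩ := key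
  simp only [hφ]
  have hsp : ∀ t ∈ spectrum ℝ T, 0 < t ∧ t < 1 / 2 := fun t ht =>
    ⟨h0m.trans_le (hspec ht).1, (hspec ht).2.trans_lt hM⟩
  have φc : ∀ c : ℝ, φ (fun _ => c) = c := by
    intro c
    have := φmul c (fun _ => 1) continuousOn_const
    simpa [φ1] using this
  have ha0 : 0 < a := by
    have := φmono (fun _ => m) (fun t => t) continuousOn_const continuousOn_id
      (fun t ht => (hspec ht).1)
    rw [φc, φid] at this
    linarith
  have ha1 : a < 1 / 2 := by
    have := φmono (fun t => t) (fun _ => M) continuousOn_id continuousOn_const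
      (fun t ht => (hspec ht).2)
    rw [φc, φid] at this
    linarith
  clear hφ
  have hA : 0 < (1 - a) / a := div_pos (by linarith) ha0
  have hA' : (1 - a) * a⁻¹ = (1 - a) / a := rfl
  have hAr : ((1 - a) / a) ^ r = Real.exp (r * Real.log ((1 - a) / a)) := by
    rw [Real.rpow_def_of_pos hA, mul_comm]
  have hq : ∀ t ∈ spectrum ℝ T, 0 < (1 - t) / t := fun t ht =>
    div_pos (by linarith [(hsp t ht).2]) (hsp t ht).1
  have ne0 : ∀ t ∈ spectrum ℝ T, t ≠ 0 := fun t ht => (hsp t ht).1.ne'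
  have ne1 : ∀ t ∈ spectrum ℝ T, 1 - t ≠ 0 := fun t ht => by linarith [(hsp t ht).2]
  have c1 : ContinuousOn (fun t : ℝ => (1 - t) / t) (spectrum ℝ T) :=
    (by fun_prop : ContinuousOn (fun t : ℝ => 1 - t) _).div continuousOn_id ne0
  have c2 : ContinuousOn (fun t : ℝ => ((1 - t) / t) ^ r) (spectrum ℝ T) :=
    c1.rpow_const (fun t ht => Or.inl (hq t ht).ne')
  have c3 : ContinuousOn (fun t : ℝ => Real.log (((1 - t) / t) ^ r)) (spectrum ℝ T) :=
    c2.log (fun t ht => (Real.rpow_pos_of_pos (hq t ht) r).ne')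
  have c4 : ContinuousOn (fun t : ℝ => 1 / (1 - t)) (spectrum ℝ T) :=
    continuousOn_const.div (by fun_prop) ne1
  have c5 : ContinuousOn (fun t : ℝ => 1 / (t * (1 - t))) (spectrum ℝ T) :=
    continuousOn_const.div (by fun_prop) (fun t ht => mul_ne_zero (ne0 t ht) (ne1 t ht))
  have c6 : ContinuousOn (fun t : ℝ => Real.exp (r * (1 - a)⁻¹ * (1 - t / a)))
      (spectrum ℝ T) := by fun_prop
  have c7 : ContinuousOn (fun t : ℝ => Real.exp (r * (1 - t)⁻¹ * (a / t - 1)))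
      (spectrum ℝ T) := by
    have d1 : ContinuousOn (fun t : ℝ => (1 - t)⁻¹) (spectrum ℝ T) :=
      ContinuousOn.inv₀ (by fun_prop) ne1
    have d2 : ContinuousOn (fun t : ℝ => a / t) (spectrum ℝ T) :=
      continuousOn_const.div continuousOn_id ne0
    exact Real.continuous_exp.comp_continuousOn
      ((continuousOn_const.mul d1).mul (d2.sub continuousOn_const))
  have hlog : ∀ t ∈ spectrum ℝ T,
      Real.log (((1 - t) / t) ^ r) = r * Real.log ((1 - t) / t) := fun t ht =>
    Real.log_rpow (hq t ht) r
  have ha1' : 1 - a ≠ 0 := by linarith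
  have g1 : ∀ t ∈ spectrum ℝ T, r * (1 - a)⁻¹ * (1 - t / a) ≤
      r * Real.log ((1 - t) / t) - r * Real.log ((1 - a) / a) := by
    intro t ht
    have := mul_le_mul_of_nonneg_left
      (ky_grad a t ha0 ha1 (hsp t ht).1 (hsp t ht).2) hr.le
    have e : r * (1 - a)⁻¹ * (1 - t / a) = r * ((a - t) / (a * (1 - a))) := by
      field_simp
    rw [e]; linarith
  have g2 : ∀ t ∈ spectrum ℝ T, 
      r * Real.log ((1 - t) / t) - r * Real.log ((1 - a) / a) ≤
        r * (1 - t)⁻¹ * (a / t - 1) := by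
    intro t ht
    have := mul_le_mul_of_nonneg_left
      (ky_grad t a (hsp t ht).1 (hsp t ht).2 ha0 ha1) hr.le
    have n0 := ne0 t ht
    have n1 := ne1 t ht
    have e : r * (1 - t)⁻¹ * (a / t - 1) = -(r * ((t - a) / (t * (1 - t)))) := by
      field_simp
      ring
    rw [e]; linarith
  -- the linear lower function has mean zero
  have φlin : ∀ b : ℝ, φ (fun t => b + r * (1 - a)⁻¹ * (1 - t / a)) = b := by
    intro b
    have e : (fun t : ℝ => b + r * (1 - a)⁻¹ * (1 - t / a)) =
        fun t => (b + r * (1 - a)⁻¹) + (-(r * (1 - a)⁻¹ / a)) * t := by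
      funext t; ring
    rw [e, φadd (fun _ => b + r * (1 - a)⁻¹) (fun t => (-(r * (1 - a)⁻¹ / a)) * t)
      continuousOn_const (by fun_prop), φc, φmul _ (fun t => t) continuousOn_id, φid]
    field_simp
    ring
  have hratio : ∀ t ∈ spectrum ℝ T, (((1 - a) / a) ^ r)⁻¹ * ((1 - t) / t) ^ r =
      Real.exp (r * Real.log ((1 - t) / t) - r * Real.log ((1 - a) / a)) := by
    intro t ht
    rw [hAr, Real.rpow_def_of_pos (hq t ht), Real.exp_sub, mul_comm (Real.log ((1 - t) / t))]
    ring
  have hdiv : φ (fun t => ((1 - t) / t) ^ r) / ((1 - a) / a) ^ r =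
      φ (fun t => (((1 - a) / a) ^ r)⁻¹ * ((1 - t) / t) ^ r) := by
    rw [φmul _ (fun t : ℝ => ((1 - t) / t) ^ r) c2]; ring
  have c8 : ContinuousOn (fun t : ℝ => (((1 - a) / a) ^ r)⁻¹ * ((1 - t) / t) ^ r)
      (spectrum ℝ T) := continuousOn_const.mul c2
  rw [hA', hdiv]
  refine ⟨⟨?_, ?_⟩, ?_, ?_, ?_⟩
  · rw [hAr, ← Real.exp_sub, Real.one_le_exp_iff]
    have := φmono (fun t => r * Real.log ((1 - a) / a) + r * (1 - a)⁻¹ * (1 - t / a))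
      (fun t : ℝ => Real.log (((1 - t) / t) ^ r)) (by fun_prop) c3 (by
        intro t ht
        have := g1 t ht
        try simp only
        rw [hlog t ht]; linarith)
    rw [φlin] at this
    linarith
  · rw [hAr, ← Real.exp_sub, Real.exp_le_exp]
    have e1 := φmono (fun t : ℝ => Real.log (((1 - t) / t) ^ r))
      (fun t => r * Real.log ((1 - a) / a) +
        ((r * a) * (1 / (t * (1 - t))) + (-r) * (1 / (1 - t)))) c3
      (continuousOn_const.add ((continuousOn_const.mul c5).add (continuousOn_const.mul c4))) (by
        intro t ht
        have h := g2 t ht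
        have n0 := ne0 t ht
        have n1 := ne1 t ht
        have e : r * (1 - t)⁻¹ * (a / t - 1) =
          (r * a) * (1 / (t * (1 - t))) + (-r) * (1 / (1 - t)) := by
          field_simp
          ring
        try simp only
        rw [hlog t ht]; linarith)
    rw [φadd (fun _ => r * Real.log ((1 - a) / a))
        (fun t => (r * a) * (1 / (t * (1 - t))) + (-r) * (1 / (1 - t))) continuousOn_const
        ((continuousOn_const.mul c5).add (continuousOn_const.mul c4)),
      φadd (fun t => (r * a) * (1 / (t * (1 - t)))) (fun t => (-r) * (1 / (1 - t)))
        (continuousOn_const.mul c5) (continuousOn_const.mul c4),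
      φmul _ (fun t => 1 / (t * (1 - t))) c5, φmul _ (fun t => 1 / (1 - t)) c4, φc] at e1
    linarith
  · have := φmono (fun t => 1 + r * (1 - a)⁻¹ * (1 - t / a)) _ (by fun_prop) c6 (by
      intro t ht
      have := Real.add_one_le_exp (r * (1 - a)⁻¹ * (1 - t / a))
      try simp only
      linarith)
    rwa [φlin] at this
  · refine φmono _ _ c6 c8 (fun t ht => ?_)
    try simp only
    rw [hratio t ht]
    exact Real.exp_le_exp.2 (g1 t ht)
  · refine φmono _ _ c8 c7 (fun t ht => ?_)
    try simp only
    rw [hratio t ht]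
    exact Real.exp_le_exp.2 (g2 t ht)
end

section
/- (Mond–Pečarić inequality) Let f : [m, M] → ℝ be a continuous convex function. Then for every unit vector x ∈ E, f(⟨Tx, x⟩) ≤ ⟨f(T) x, x⟩. -/
open scoped InnerProductSpace

lemma mp_aux
    {E : Type*} [NormedAddCommGroup E] [InnerProductSpace ℂ E] [CompleteSpace E]
    (T : E →L[ℂ] E) (hT : IsSelfAdjoint T) (f : ℝ → ℝ)
    (hf : ContinuousOn f (spectrum ℝ T)) (c d : ℝ)
    (h : ∀ t ∈ spectrum ℝ T, c * t + d ≤ f t) (x : E) (hx : ‖x‖ = 1) :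
    c * RCLike.re ⟪T x, x⟫_ℂ + d ≤ RCLike.re ⟪(cfc f T) x, x⟫_ℂ := by
  have h1 : cfc (fun t : ℝ => c * t + d) T ≤ cfc f T :=
    cfc_mono h (by fun_prop) hf
  have h2 : cfc (fun t : ℝ => c * t + d) T = c • T + algebraMap ℝ (E →L[ℂ] E) d := by
    rw [cfc_add_const d (fun t => c * t) T (by fun_prop) hT, cfc_const_mul_id c T hT]
  rw [h2, ContinuousLinearMap.le_def] at h1
  have h3 := h1.re_inner_nonneg_left x
  have h4 : (algebraMap ℝ (E →L[ℂ] E) d) x = (d : ℂ) • x := by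
    rw [Algebra.algebraMap_eq_smul_one]; simp
  have h5 : (c • T) x = (c : ℂ) • T x := by simp
  have h6 : ⟪x, x⟫_ℂ = 1 := by rw [inner_self_eq_norm_sq_to_K, hx]; simp
  rw [ContinuousLinearMap.sub_apply, ContinuousLinearMap.add_apply, h4, h5, inner_sub_left,
    inner_add_left, inner_smul_left, inner_smul_left, h6] at h3
  simp at h3 ⊢
  linarith

theorem mond_pecaric_inequality
    {E : Type*} [NormedAddCommGroup E] [InnerProductSpace ℂ E] [CompleteSpace E]
    (T : E →L[ℂ] E) (hT : IsSelfAdjoint T) (m M : ℝ) (hmM : m < M)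
    (hspec : spectrum ℝ T ⊆ Set.Icc m M)
    (f : ℝ → ℝ) (hf_cont : ContinuousOn f (Set.Icc m M))
    (hf_conv : ConvexOn ℝ (Set.Icc m M) f)
    (x : E) (hx : ‖x‖ = 1) :
    f (RCLike.re ⟪T x, x⟫_ℂ) ≤ RCLike.re ⟪(cfc f T) x, x⟫_ℂ := by
  have hid : cfc (fun t : ℝ => t) T = T := cfc_id' ℝ T hT
  have hlo := mp_aux T hT (fun t => t) continuousOn_id 0 m
    (fun t ht => by simpa using (hspec ht).1) x hx
  have hhi := mp_aux T hT (fun t => -t) continuousOn_id.neg 0 (-M)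
    (fun t ht => by simpa using (hspec ht).2) x hx
  rw [cfc_neg, hid] at hhi
  rw [hid] at hlo
  have hmem : RCLike.re ⟪T x, x⟫_ℂ ∈ Set.Icc m M := by
    simp at hlo hhi ⊢
    exact ⟨hlo, hhi⟩
  refine le_of_forall_lt fun a ha => ?_
  obtain ⟨b, hab, hb⟩ := exists_between ha
  obtain ⟨c, d, hle, heq⟩ := hf_conv.exists_affine_le_of_lt_real hmem hb isClosed_Icc
    hf_cont.lowerSemicontinuousOn
  have := mp_aux T hT f (hf_cont.mono hspec) c d (fun t ht => hle t (hspec ht)) x hx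
  linarith
end
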